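/- As γ → +∞ we have ‖u_γ‖_{L²(Ω)} → √(l/λ₁) and γ^{−1} log(1/β_γ) = v₁(0)‖u_γ‖_{L²(Ω)} + o(‖u_γ‖_{L²(Ω)}); in particular β_γ = o(1/γ). -/

import Mathlib

open Real Set Filter MeasureTheory Topology

noncomputable section

/-- The radial Laplacian with the sign convention Δ = −div(∇·):
for a radial C² function, (Δu)(r) = −u''(r) − u'(r)/r. -/
def radLap (u : ℝ → ℝ) (r : ℝ) : ℝ := -(deriv (deriv u) r) - deriv u r / r

/-- `EigenCtx lam1 v1` : λ₁ > 0 is the first radial Dirichlet eigenvalue of Δ = −div∇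
on the unit disk, with radial eigenfunction v₁: v₁ smooth on [0,1], Δv₁ = λ₁v₁ in Ω,
v₁ > 0 in Ω, v₁(1) = 0 and ∫_Ω v₁² dy = ∫₀¹ v₁(r)² 2πr dr = 1. -/
def EigenCtx (lam1 : ℝ) (v1 : ℝ → ℝ) : Prop :=
  0 < lam1 ∧ ContDiffOn ℝ (⊤ : ℕ∞) v1 (Set.Icc 0 1) ∧
    (∀ r ∈ Set.Ioo (0:ℝ) 1, radLap v1 r = lam1 * v1 r) ∧
    (∀ r ∈ Set.Ico (0:ℝ) 1, 0 < v1 r) ∧ v1 1 = 0 ∧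
    (∫ r in Set.Ioo (0:ℝ) 1, (v1 r) ^ 2 * (2 * π * r)) = 1

/-- `IsRadSol lam beta gam u` : u is a smooth radial function on the closed unit disk,
positive in the open disk, vanishing on the boundary, with central value γ, solving
Δu = λu + βu e^{u²} in Ω (radially). -/
def IsRadSol (lam beta gam : ℝ) (u : ℝ → ℝ) : Prop :=
  ContDiffOn ℝ (⊤ : ℕ∞) u (Set.Icc 0 1) ∧
    (∀ r ∈ Set.Ioo (0:ℝ) 1,
      radLap u r = lam * u r + beta * u r * Real.exp ((u r) ^ 2)) ∧
    (∀ r ∈ Set.Ico (0:ℝ) 1, 0 < u r) ∧ u 1 = 0 ∧ u 0 = gam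

/-- λ̄_γ = λ₁ − ε_γ with ε_γ = (4π v₁(0)/γ)√(λ₁/l). -/
def lamBar (lam1 v10 l γ : ℝ) : ℝ := lam1 - 4 * π * v10 / γ * Real.sqrt (lam1 / l)

/-- The family (β_γ, u_γ) of Theorem 1: for every γ > 0 with λ̄_γ > 0, β_γ > 0 and u_γ
is a smooth positive radial solution of Δu = λ̄_γ u + β_γ u e^{u²} with u_γ(0) = γ. -/
def GoodFamily (lam1 : ℝ) (v1 : ℝ → ℝ) (l : ℝ) (β : ℝ → ℝ) (u : ℝ → ℝ → ℝ) : Prop :=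
  ∀ γ : ℝ, 0 < γ → 0 < lamBar lam1 (v1 0) l γ →
    0 < β γ ∧ IsRadSol (lamBar lam1 (v1 0) l γ) (β γ) γ (u γ)

/-- Dirichlet energy ∫_Ω |∇u|² dy of a radial function, = ∫₀¹ u'(r)² 2πr dr. -/
def dirEnergy (u : ℝ → ℝ) : ℝ := ∫ r in Set.Ioo (0:ℝ) 1, (deriv u r) ^ 2 * (2 * π * r)

/-- L² norm ‖u‖_{L²(Ω)} of a radial function. -/
def l2norm (u : ℝ → ℝ) : ℝ := Real.sqrt (∫ r in Set.Ioo (0:ℝ) 1, (u r) ^ 2 * (2 * π * r))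

/-! ### Monotonicity on the half-line -/

theorem le_of_hasDerivAt_nonneg {f f' : ℝ → ℝ} (hc : ContinuousOn f (Ici 0))
    (hd : ∀ t, 0 < t → HasDerivAt f (f' t) t) {a b : ℝ} (ha : 0 ≤ a) (hab : a ≤ b)
    (h : ∀ t, a < t → t < b → 0 ≤ f' t) : f a ≤ f b := by
  have hm : MonotoneOn f (Icc a b) := by
    refine monotoneOn_of_hasDerivWithinAt_nonneg (f' := f') (convex_Icc a b)
      (hc.mono fun t ht => ha.trans ht.1) ?_ ?_
    · intro t ht
      rw [interior_Icc] at ht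
      exact (hd t (ha.trans_lt ht.1)).hasDerivWithinAt
    · intro t ht
      rw [interior_Icc] at ht
      exact h t ht.1 ht.2
  exact hm (left_mem_Icc.2 hab) (right_mem_Icc.2 hab) hab

theorem ge_of_hasDerivAt_nonpos {f f' : ℝ → ℝ} (hc : ContinuousOn f (Ici 0))
    (hd : ∀ t, 0 < t → HasDerivAt f (f' t) t) {a b : ℝ} (ha : 0 ≤ a) (hab : a ≤ b)
    (h : ∀ t, a < t → t < b → f' t ≤ 0) : f b ≤ f a := by
  have := le_of_hasDerivAt_nonneg (f := fun t => -f t) (f' := fun t => -f' t) hc.neg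
    (fun t ht => (hd t ht).neg) ha hab (fun t h1 h2 => neg_nonneg.2 (h t h1 h2))
  simpa using this

theorem le_lim_of_hasDerivAt_nonneg {f f' : ℝ → ℝ} {c : ℝ} (hc : ContinuousOn f (Ici 0))
    (hd : ∀ t, 0 < t → HasDerivAt f (f' t) t) (hl : Tendsto f atTop (𝓝 c)) {a : ℝ} (ha : 0 ≤ a)
    (h : ∀ t, a < t → 0 ≤ f' t) : f a ≤ c :=
  ge_of_tendsto hl ((eventually_ge_atTop a).mono fun _ hb =>
    le_of_hasDerivAt_nonneg hc hd ha hb fun t h1 _ => h t h1)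

theorem lim_le_of_hasDerivAt_nonpos {f f' : ℝ → ℝ} {c : ℝ} (hc : ContinuousOn f (Ici 0))
    (hd : ∀ t, 0 < t → HasDerivAt f (f' t) t) (hl : Tendsto f atTop (𝓝 c)) {a : ℝ} (ha : 0 ≤ a)
    (h : ∀ t, a < t → f' t ≤ 0) : c ≤ f a :=
  le_of_tendsto hl ((eventually_ge_atTop a).mono fun _ hb =>
    ge_of_hasDerivAt_nonpos hc hd ha hb fun t h1 _ => h t h1)

theorem hasDerivAt_exp_neg_two (t : ℝ) :
    HasDerivAt (fun t : ℝ => exp (-2 * t)) (-2 * exp (-2 * t)) t := by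
  have := ((hasDerivAt_id t).const_mul (-2 : ℝ)).exp
  simpa [mul_comm] using this

theorem tendsto_exp_neg_two : Tendsto (fun t : ℝ => exp (-2 * t)) atTop (𝓝 0) :=
  tendsto_exp_atBot.comp (tendsto_id.const_mul_atTop_of_neg (by norm_num))

/-! ### Radial solutions in the variable `t = log (1 / r)` -/

/-- The nonlinear part `β exp (U² - 2 * t)` of the right-hand side. -/
def dens (β : ℝ) (U : ℝ → ℝ) (t : ℝ) : ℝ := β * exp (U t ^ 2 - 2 * t)

/-- `U t = u (exp (-t))` and `y = U'` for a radial solution `u` of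
`Δu = lam u + β u exp (u²)` on the unit disk which vanishes on the boundary, `u 0 = γ`. -/
structure Profile (lam β γ : ℝ) (U y : ℝ → ℝ) : Prop where
  contU : ContinuousOn U (Ici 0)
  conty : ContinuousOn y (Ici 0)
  derU : ∀ t, 0 < t → HasDerivAt U (y t) t
  dery : ∀ t, 0 < t → HasDerivAt y (-(U t * (lam * exp (-2 * t) + dens β U t))) t
  limU : Tendsto U atTop (𝓝 γ)
  limy : Tendsto y atTop (𝓝 0)
  U0 : U 0 = 0
  Upos : ∀ t, 0 < t → 0 < U t

namespace Profile

variable {lam β γ : ℝ} {U y : ℝ → ℝ}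

theorem dens_nonneg (hβ : 0 ≤ β) (U : ℝ → ℝ) (t : ℝ) : 0 ≤ dens β U t :=
  mul_nonneg hβ (exp_pos _).le

theorem Unonneg (h : Profile lam β γ U y) {t : ℝ} (ht : 0 ≤ t) : 0 ≤ U t := by
  rcases ht.eq_or_lt with rfl | ht
  · exact h.U0.ge
  · exact (h.Upos t ht).le

theorem rhs_nonneg (hl : 0 ≤ lam) (hβ : 0 ≤ β) (t : ℝ) :
    0 ≤ lam * exp (-2 * t) + dens β U t :=
  add_nonneg (mul_nonneg hl (exp_pos _).le) (dens_nonneg hβ U t)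

theorem y_anti (h : Profile lam β γ U y) (hl : 0 ≤ lam) (hβ : 0 ≤ β) {a b : ℝ} (ha : 0 ≤ a)
    (hab : a ≤ b) : y b ≤ y a :=
  ge_of_hasDerivAt_nonpos h.conty h.dery ha hab fun t h1 _ =>
    neg_nonpos.2 (mul_nonneg (h.Unonneg (ha.trans h1.le)) (rhs_nonneg hl hβ t))

theorem y_nonneg (h : Profile lam β γ U y) (hl : 0 ≤ lam) (hβ : 0 ≤ β) {a : ℝ} (ha : 0 ≤ a) :
    0 ≤ y a :=
  le_of_tendsto h.limy ((eventually_ge_atTop a).mono fun _ hb => h.y_anti hl hβ ha hb)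

theorem U_mono (h : Profile lam β γ U y) (hl : 0 ≤ lam) (hβ : 0 ≤ β) {a b : ℝ} (ha : 0 ≤ a)
    (hab : a ≤ b) : U a ≤ U b :=
  le_of_hasDerivAt_nonneg h.contU h.derU ha hab fun _ h1 _ => h.y_nonneg hl hβ (ha.trans h1.le)

theorem U_le (h : Profile lam β γ U y) (hl : 0 ≤ lam) (hβ : 0 ≤ β) {a : ℝ} (ha : 0 ≤ a) :
    U a ≤ γ :=
  ge_of_tendsto h.limU ((eventually_ge_atTop a).mono fun _ hb => h.U_mono hl hβ ha hb)

theorem gamma_pos (h : Profile lam β γ U y) (hl : 0 ≤ lam) (hβ : 0 ≤ β) : 0 < γ :=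
  (h.Upos 1 one_pos).trans_le (h.U_le hl hβ zero_le_one)

theorem hasDerivAt_dens (h : Profile lam β γ U y) {t : ℝ} (ht : 0 < t) :
    HasDerivAt (dens β U) ((2 * U t * y t - 2) * dens β U t) t := by
  have := ((((h.derU t ht).pow 2).sub ((hasDerivAt_id t).const_mul (2 : ℝ))).exp).const_mul β
  refine this.congr_deriv ?_
  simp only [dens, Pi.sub_apply, Pi.pow_apply, id]
  push_cast
  ring

theorem continuousOn_dens (h : Profile lam β γ U y) : ContinuousOn (dens β U) (Ici 0) := by
  have := h.contU
  unfold dens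
  fun_prop

theorem tendsto_dens (h : Profile lam β γ U y) : Tendsto (dens β U) atTop (𝓝 0) := by
  have h1 : Tendsto (fun t => β * exp (U t ^ 2) * exp (-2 * t)) atTop
      (𝓝 (β * exp (γ ^ 2) * 0)) :=
    (((continuous_exp.tendsto _).comp (h.limU.pow 2)).const_mul β).mul tendsto_exp_neg_two
  rw [mul_zero] at h1
  refine h1.congr fun t => ?_
  rw [dens, mul_assoc, ← exp_add]
  ring_nf

/-- Lower Pohozaev inequality. -/
theorem pohozaev_lower (h : Profile lam β γ U y) (hl : 0 ≤ lam) (hβ : 0 ≤ β) {t : ℝ}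
    (ht : 0 ≤ t) : y t * (2 / γ - y t) ≤ lam * exp (-2 * t) + dens β U t := by
  have hγ := h.gamma_pos hl hβ
  have hcy := h.conty
  have hcd := h.continuousOn_dens
  have key : 0 ≤ (fun t => lam * exp (-2 * t) + dens β U t + y t ^ 2 - 2 / γ * y t) t := by
    refine lim_le_of_hasDerivAt_nonpos (by fun_prop)
      (fun t ht => ((((hasDerivAt_exp_neg_two t).const_mul lam).add (h.hasDerivAt_dens ht)).add
        ((h.dery t ht).pow 2)).sub ((h.dery t ht).const_mul (2 / γ))) ?_ ht ?_
    · have := (((tendsto_exp_neg_two.const_mul lam).add h.tendsto_dens).add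
        (h.limy.pow 2)).sub (h.limy.const_mul (2 / γ))
      simp only [mul_zero, sub_zero, add_zero, ne_eq, OfNat.ofNat_ne_zero, not_false_eq_true, zero_pow] at this
      exact this
    · intro s hs
      have hs0 := ht.trans hs.le
      have h1 := h.y_nonneg hl hβ hs0
      have h2 := h.Unonneg hs0
      have h3 := rhs_nonneg (U := U) hl hβ s
      have h4 : U s / γ ≤ 1 := (div_le_one hγ).2 (h.U_le hl hβ hs0)
      have h5 : 0 ≤ lam * exp (-2 * s) * (U s * y s) := by positivity
      have h6 := mul_le_mul_of_nonneg_left h4 h3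
      push_cast
      have h7 : 2 / γ * -(U s * (lam * exp (-2 * s) + dens β U s)) =
        -2 * ((lam * exp (-2 * s) + dens β U s) * (U s / γ)) := by ring
      rw [h7]
      nlinarith
  simp only at key
  linarith

/-- Upper Pohozaev inequality. -/
theorem pohozaev_upper (h : Profile lam β γ U y) (hl : 0 ≤ lam) (hβ : 0 ≤ β) {t : ℝ}
    (ht : 0 < t) : lam * exp (-2 * t) + dens β U t + y t ^ 2 ≤
      y t * (2 / U t + lam * γ * exp (-2 * t)) := by
  have hγ := h.gamma_pos hl hβ
  have hcy := h.conty
  have hcd := h.continuousOn_dens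
  have hUt := h.Upos t ht
  have key : (fun s => lam * exp (-2 * s) + dens β U s + y s ^ 2 - 2 / U t * y s -
      lam * γ * y t * exp (-2 * s)) t ≤ 0 := by
    refine le_lim_of_hasDerivAt_nonneg (by fun_prop)
      (fun s hs => (((((hasDerivAt_exp_neg_two s).const_mul lam).add (h.hasDerivAt_dens hs)).add
        ((h.dery s hs).pow 2)).sub ((h.dery s hs).const_mul (2 / U t))).sub
          ((hasDerivAt_exp_neg_two s).const_mul _)) ?_ ht.le ?_
    · have := ((((tendsto_exp_neg_two.const_mul lam).add h.tendsto_dens).add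
        (h.limy.pow 2)).sub (h.limy.const_mul (2 / U t))).sub
        (tendsto_exp_neg_two.const_mul (lam * γ * y t))
      simp only [mul_zero, sub_zero, add_zero, ne_eq, OfNat.ofNat_ne_zero, not_false_eq_true, zero_pow] at this
      exact this
    · intro s hs
      have hs0 := ht.le.trans hs.le
      have h1 := h.y_nonneg hl hβ hs0
      have h2 := h.Unonneg hs0
      have h3 := rhs_nonneg (U := U) hl hβ s
      have h4 : 1 ≤ U s / U t := (one_le_div hUt).2 (h.U_mono hl hβ ht.le hs.le)
      have h5 : U s * y s ≤ γ * y t :=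
        mul_le_mul (h.U_le hl hβ hs0) (h.y_anti hl hβ ht.le hs.le) h1 hγ.le
      have h8 : lam * exp (-2 * s) * (U s * y s) ≤ lam * exp (-2 * s) * (γ * y t) :=
        mul_le_mul_of_nonneg_left h5 (by positivity)
      have h6 := mul_le_mul_of_nonneg_left h4 h3
      push_cast
      have h7 : 2 / U t * -(U s * (lam * exp (-2 * s) + dens β U s)) =
        -2 * ((lam * exp (-2 * s) + dens β U s) * (U s / U t)) := by ring
      rw [h7]
      nlinarith
  simp only at key
  linarith

theorem y_le (h : Profile lam β γ U y) (hl : 0 ≤ lam) (hβ : 0 ≤ β) {t : ℝ} (ht : 0 < t) :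
    y t ≤ 2 / U t + lam * γ * exp (-2 * t) := by
  have h1 := h.pohozaev_upper hl hβ ht
  have h2 := rhs_nonneg (U := U) hl hβ t
  have h3 := h.y_nonneg hl hβ ht.le
  have hγ := h.gamma_pos hl hβ
  have hUt := h.Upos t ht
  rcases h3.eq_or_lt with h0 | h0
  · rw [← h0]; positivity
  · exact le_of_mul_le_mul_left (by nlinarith) h0

theorem lin_le_y (h : Profile lam β γ U y) (hl : 0 ≤ lam) (hβ : 0 ≤ β) {t : ℝ} (ht : 0 ≤ t) :
    lam * U t * exp (-2 * t) / 2 ≤ y t := by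
  have hcy := h.conty
  have key : 0 ≤ (fun s => y s - lam * U t / 2 * exp (-2 * s)) t := by
    refine lim_le_of_hasDerivAt_nonpos (by fun_prop)
      (fun s hs => (h.dery s hs).sub ((hasDerivAt_exp_neg_two s).const_mul _)) ?_ ht ?_
    · have := h.limy.sub (tendsto_exp_neg_two.const_mul (lam * U t / 2))
      simp only [mul_zero, sub_zero] at this
      exact this
    · intro s hs
      have h1 := h.U_mono hl hβ ht hs.le
      have h2 : 0 ≤ U s * dens β U s := mul_nonneg (h.Unonneg (ht.trans hs.le)) (dens_nonneg hβ U s)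
      have h3 : lam * exp (-2 * s) * U t ≤ lam * exp (-2 * s) * U s :=
        mul_le_mul_of_nonneg_left h1 (by positivity)
      nlinarith
  simp only at key
  linarith

/-- Near its maximum, `U` drops by at most `6 / γ` until its slope reaches `3 / (2γ)`. -/
theorem sq_drop (h : Profile lam β γ U y) (hl : 0 ≤ lam) (hβ : 0 ≤ β) {t : ℝ} (ht : 0 ≤ t)
    (hy : y t ≤ 3 / (2 * γ)) : γ ^ 2 - 6 ≤ U t ^ 2 := by
  have hγ := h.gamma_pos hl hβ
  have hcy := h.conty
  have hcU := h.contU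
  have key : 0 + 1 / (4 * γ) * γ ^ 2 ≤ (fun s => y s + 1 / (4 * γ) * U s ^ 2) t := by
    refine lim_le_of_hasDerivAt_nonpos (by fun_prop)
      (fun s hs => (h.dery s hs).add (((h.derU s hs).pow 2).const_mul _)) ?_ ht ?_
    · exact h.limy.add ((h.limU.pow 2).const_mul _)
    · intro s hs
      have hs0 := ht.trans hs.le
      have h1 := h.pohozaev_lower hl hβ hs0
      have h2 := h.Unonneg hs0
      have h3 := h.y_nonneg hl hβ hs0
      have h4 := (h.y_anti hl hβ ht hs.le).trans hy
      have h5 : 1 / (2 * γ) ≤ 2 / γ - y s := by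
        have : 2 / γ - 3 / (2 * γ) = 1 / (2 * γ) := by field_simp; norm_num
        linarith
      have h6 := mul_le_mul_of_nonneg_left h5 h3
      have h7 := mul_le_mul_of_nonneg_left (h6.trans h1) h2
      have h8 : 1 / (4 * γ) * (2 * U s * y s) = U s * (y s * (1 / (2 * γ))) := by
        field_simp; norm_num
      simp only [Nat.reduceSub, pow_one]
      push_cast
      linarith
  simp only at key
  have h1 : 1 / (4 * γ) * (γ ^ 2 - 6) ≤ 1 / (4 * γ) * U t ^ 2 := by
    have : 1 / (4 * γ) * (γ ^ 2 - 6) = 1 / (4 * γ) * γ ^ 2 - 3 / (2 * γ) := by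
      field_simp; ring
    linarith
  exact le_of_mul_le_mul_left h1 (by positivity)

end Profile

/-! ### Testing the equation against the first eigenfunction -/

/-- `a t` is the integral of `U V exp (-2 * s)` over `s ≥ t`. -/
structure Pairing (U V a : ℝ → ℝ) : Prop where
  cont : ContinuousOn a (Ici 0)
  der : ∀ t, 0 < t → HasDerivAt a (-(exp (-2 * t) * (U t * V t))) t
  lim : Tendsto a atTop (𝓝 0)

/-- The integral of `U V dens` over `(t, ∞)`, in terms of boundary values at `t`. -/
def mass (U y V x a : ℝ → ℝ) (ε t : ℝ) : ℝ := y t * V t - U t * x t + ε * a t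

namespace Pairing

variable {lam lam1 β γ v10 : ℝ} {U y V x a : ℝ → ℝ}

theorem hasDerivAt_mass (h : Profile lam β γ U y) (hV : Profile lam1 0 v10 V x)
    (ha : Pairing U V a) {t : ℝ} (ht : 0 < t) :
    HasDerivAt (mass U y V x a (lam1 - lam)) (-(U t * V t * dens β U t)) t := by
  have := (((h.dery t ht).mul (hV.derU t ht)).sub ((h.derU t ht).mul (hV.dery t ht))).add
    ((ha.der t ht).const_mul (lam1 - lam))
  refine this.congr_deriv ?_
  simp only [dens, zero_mul]
  ring

theorem continuousOn_mass (h : Profile lam β γ U y) (hV : Profile lam1 0 v10 V x)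
    (ha : Pairing U V a) (ε : ℝ) : ContinuousOn (mass U y V x a ε) (Ici 0) := by
  have h1 := h.contU
  have h2 := h.conty
  have h3 := hV.contU
  have h4 := hV.conty
  have h5 := ha.cont
  unfold mass
  fun_prop

theorem tendsto_mass (h : Profile lam β γ U y) (hV : Profile lam1 0 v10 V x)
    (ha : Pairing U V a) (ε : ℝ) : Tendsto (mass U y V x a ε) atTop (𝓝 0) := by
  have := ((h.limy.mul hV.limU).sub (h.limU.mul hV.limy)).add (ha.lim.const_mul ε)
  simp only [mul_zero, zero_mul, sub_zero, add_zero] at this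
  exact this

theorem mass_zero (h : Profile lam β γ U y) (hV : Profile lam1 0 v10 V x) (ε : ℝ) :
    mass U y V x a ε 0 = ε * a 0 := by
  simp [mass, h.U0, hV.U0]

theorem mass_anti (h : Profile lam β γ U y) (hV : Profile lam1 0 v10 V x)
    (ha : Pairing U V a) (hβ : 0 ≤ β) {s t : ℝ} (hs : 0 ≤ s)
    (hst : s ≤ t) : mass U y V x a (lam1 - lam) t ≤ mass U y V x a (lam1 - lam) s := by
  refine ge_of_hasDerivAt_nonpos (continuousOn_mass h hV ha _)
    (fun t ht => hasDerivAt_mass h hV ha ht) hs hst fun r hr _ => ?_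
  have h0 := hs.trans hr.le
  exact neg_nonpos.2 (mul_nonneg (mul_nonneg (h.Unonneg h0) (hV.Unonneg h0))
    (Profile.dens_nonneg hβ U r))

theorem mass_le (h : Profile lam β γ U y) (hV : Profile lam1 0 v10 V x)
    (ha : Pairing U V a) (hl : 0 ≤ lam) (hl1 : 0 ≤ lam1) (hβ : 0 ≤ β) {t : ℝ} (ht : 0 ≤ t) :
    mass U y V x a (lam1 - lam) t ≤ v10 * y t := by
  have hc := continuousOn_mass h hV ha (lam1 - lam)
  have hcy := h.conty
  have key : (fun s => mass U y V x a (lam1 - lam) s - v10 * y s) t ≤ 0 := by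
    refine le_lim_of_hasDerivAt_nonneg (by fun_prop)
      (fun s hs => (hasDerivAt_mass h hV ha hs).sub ((h.dery s hs).const_mul v10)) ?_ ht ?_
    · have := (tendsto_mass h hV ha (lam1 - lam)).sub (h.limy.const_mul v10)
      simp only [mul_zero, sub_zero] at this
      exact this
    · intro s hs
      have h0 := ht.trans hs.le
      have hv := hV.U_le hl1 le_rfl h0
      have h1 := h.Unonneg h0
      have h2 := Profile.dens_nonneg hβ U s
      have h3 : 0 ≤ (v10 - V s) * (U s * dens β U s) :=
        mul_nonneg (sub_nonneg.2 hv) (mul_nonneg h1 h2)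
      have h4 : 0 ≤ v10 * (U s * (lam * exp (-2 * s))) :=
        mul_nonneg (hV.gamma_pos hl1 le_rfl).le (by positivity)
      nlinarith
  simp only at key
  linarith

theorem le_mass (h : Profile lam β γ U y) (hV : Profile lam1 0 v10 V x)
    (ha : Pairing U V a) (hl : 0 ≤ lam) (hl1 : 0 ≤ lam1) (hβ : 0 ≤ β) {t : ℝ} (ht : 0 ≤ t) :
    V t * (y t - lam * γ * exp (-2 * t) / 2) ≤ mass U y V x a (lam1 - lam) t := by
  have hc := continuousOn_mass h hV ha (lam1 - lam)
  have hcy := h.conty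
  have key : 0 ≤ (fun s => mass U y V x a (lam1 - lam) s - V t * y s +
      V t * lam * γ / 2 * exp (-2 * s)) t := by
    refine lim_le_of_hasDerivAt_nonpos (by fun_prop)
      (fun s hs => ((hasDerivAt_mass h hV ha hs).sub ((h.dery s hs).const_mul (V t))).add
        ((hasDerivAt_exp_neg_two s).const_mul _)) ?_ ht ?_
    · have := ((tendsto_mass h hV ha (lam1 - lam)).sub (h.limy.const_mul (V t))).add
        (tendsto_exp_neg_two.const_mul (V t * lam * γ / 2))
      simp only [mul_zero, sub_zero, add_zero] at this
      exact this
    · intro s hs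
      have h0 := ht.trans hs.le
      have hv := hV.U_mono hl1 le_rfl ht hs.le
      have h1 := h.Unonneg h0
      have h2 := Profile.dens_nonneg hβ U s
      have h3 : 0 ≤ (V s - V t) * (U s * dens β U s) :=
        mul_nonneg (sub_nonneg.2 hv) (mul_nonneg h1 h2)
      have h4 : V t * (lam * exp (-2 * s)) * U s ≤ V t * (lam * exp (-2 * s)) * γ :=
        mul_le_mul_of_nonneg_left (h.U_le hl hβ h0)
          (mul_nonneg (hV.Unonneg ht) (by positivity))
      nlinarith
  simp only at key
  linarith

theorem mass_le_add (h : Profile lam β γ U y) (hV : Profile lam1 0 v10 V x)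
    (ha : Pairing U V a) (hl : 0 ≤ lam) (hl1 : 0 ≤ lam1) (hβ : 0 ≤ β) {s t δ : ℝ} (hs : 0 ≤ s)
    (hst : s ≤ t) (hδ : ∀ r, s < r → r < t → dens β U r ≤ δ) :
    mass U y V x a (lam1 - lam) s ≤ mass U y V x a (lam1 - lam) t + v10 * γ * δ * (t - s) := by
  have hc := continuousOn_mass h hV ha (lam1 - lam)
  have key : (fun r => mass U y V x a (lam1 - lam) r + v10 * γ * δ * r) s ≤
      (fun r => mass U y V x a (lam1 - lam) r + v10 * γ * δ * r) t := by
    refine le_of_hasDerivAt_nonneg (by fun_prop)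
      (fun r hr => (hasDerivAt_mass h hV ha hr).add ((hasDerivAt_id r).const_mul _)) hs hst ?_
    intro r h1 h2
    have h0 := hs.trans h1.le
    have h3 : U r * V r * dens β U r ≤ γ * v10 * δ :=
      mul_le_mul (mul_le_mul (h.U_le hl hβ h0) (hV.U_le hl1 le_rfl h0) (hV.Unonneg h0)
        (h.gamma_pos hl hβ).le) (hδ r h1 h2) (Profile.dens_nonneg hβ U r)
        (mul_nonneg (h.gamma_pos hl hβ).le (hV.gamma_pos hl1 le_rfl).le)
    linarith
  simp only at key
  linarith

theorem anti (h : Profile lam β γ U y) (hV : Profile lam1 0 v10 V x)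
    (ha : Pairing U V a) {s t : ℝ} (hs : 0 ≤ s) (hst : s ≤ t) : a t ≤ a s := by
  refine ge_of_hasDerivAt_nonpos ha.cont ha.der hs hst fun r hr _ => ?_
  have h0 := hs.trans hr.le
  exact neg_nonpos.2 (mul_nonneg (exp_pos _).le (mul_nonneg (h.Unonneg h0) (hV.Unonneg h0)))

theorem le_pairing (h : Profile lam β γ U y) (hV : Profile lam1 0 v10 V x)
    (ha : Pairing U V a) (hl : 0 ≤ lam) (hl1 : 0 ≤ lam1) (hβ : 0 ≤ β) {t : ℝ} (ht : 0 ≤ t) :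
    U t * V t * exp (-2 * t) / 2 ≤ a t := by
  have hc := ha.cont
  have key : 0 ≤ (fun s => a s - U t * V t / 2 * exp (-2 * s)) t := by
    refine lim_le_of_hasDerivAt_nonpos (by fun_prop)
      (fun s hs => (ha.der s hs).sub ((hasDerivAt_exp_neg_two s).const_mul _)) ?_ ht ?_
    · have := ha.lim.sub (tendsto_exp_neg_two.const_mul (U t * V t / 2))
      simp only [mul_zero, sub_zero] at this
      exact this
    · intro s hs
      have h3 : U t * V t ≤ U s * V s := mul_le_mul (h.U_mono hl hβ ht hs.le)
        (hV.U_mono hl1 le_rfl ht hs.le) (hV.Unonneg ht) (h.Unonneg (ht.trans hs.le))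
      have h4 := mul_le_mul_of_nonneg_left h3 (exp_pos (-2 * s)).le
      linarith
  simp only at key
  linarith

/-- If `U` is dominated by an affine function on `(0, T)`, so is the pairing. -/
theorem pairing_zero_le (h : Profile lam β γ U y) (hV : Profile lam1 0 v10 V x)
    (ha : Pairing U V a) (hl : 0 ≤ lam) (hl1 : 0 ≤ lam1) (hβ : 0 ≤ β) {T p q : ℝ} (hT : 0 ≤ T)
    (hp : 0 ≤ p) (hq : 0 ≤ q) (hU : ∀ t, 0 < t → t < T → U t ≤ p + q * t) :
    a 0 ≤ γ * v10 * exp (-2 * T) / 2 + v10 * (p / 2 + q / 4) := by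
  have hc := ha.cont
  have hv := hV.gamma_pos hl1 le_rfl
  have h1 : a T ≤ γ * v10 * exp (-2 * T) / 2 := by
    have key : (fun s => a s - γ * v10 / 2 * exp (-2 * s)) T ≤ 0 := by
      refine le_lim_of_hasDerivAt_nonneg (by fun_prop)
        (fun s hs => (ha.der s hs).sub ((hasDerivAt_exp_neg_two s).const_mul _)) ?_ hT ?_
      · have := ha.lim.sub (tendsto_exp_neg_two.const_mul (γ * v10 / 2))
        simp only [mul_zero, sub_zero] at this
        exact this
      · intro s hs
        have h0 := hT.trans hs.le
        have h3 : U s * V s ≤ γ * v10 := mul_le_mul (h.U_le hl hβ h0)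
          (hV.U_le hl1 le_rfl h0) (hV.Unonneg h0) (h.gamma_pos hl hβ).le
        have h4 := mul_le_mul_of_nonneg_left h3 (exp_pos (-2 * s)).le
        linarith
    simp only at key
    linarith
  have key : (fun s => a s - v10 * ((p / 2 + q / 4 + q / 2 * s) * exp (-2 * s))) 0 ≤
      (fun s => a s - v10 * ((p / 2 + q / 4 + q / 2 * s) * exp (-2 * s))) T := by
    refine le_of_hasDerivAt_nonneg (by fun_prop)
      (fun s hs => (ha.der s hs).sub (((((hasDerivAt_id s).const_mul (q / 2)).const_add
        (p / 2 + q / 4)).mul (hasDerivAt_exp_neg_two s)).const_mul v10)) le_rfl hT ?_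
    intro s h1 h2
    have h3 : U s * V s ≤ (p + q * s) * v10 := mul_le_mul (hU s h1 h2)
      (hV.U_le hl1 le_rfl h1.le) (hV.Unonneg h1.le) (by positivity)
    have h4 := mul_le_mul_of_nonneg_left h3 (exp_pos (-2 * s)).le
    simp only [id]
    linarith
  have h2 : 0 ≤ v10 * ((p / 2 + q / 4 + q / 2 * T) * exp (-2 * T)) := by positivity
  simp only [mul_zero, exp_zero, add_zero, mul_one] at key
  linarith

end Pairing

/-! ### Concentration near the origin -/

namespace Profile

variable {lam β γ : ℝ} {U y : ℝ → ℝ}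

theorem exists_slope (h : Profile lam β γ U y) (hl : 0 ≤ lam) (hβ : 0 ≤ β) (hγ : 10 ≤ γ) :
    ∃ T, 0 < T ∧ y T = 3 / (2 * γ) := by
  have h0 : 3 / (2 * γ) < y 0 := by
    by_contra! hc
    have := h.sq_drop hl hβ le_rfl hc
    rw [h.U0] at this
    nlinarith
  obtain ⟨b, hb, hb0⟩ := ((h.limy.eventually (gt_mem_nhds
    (show (0:ℝ) < 3 / (2 * γ) by positivity))).and (eventually_gt_atTop 0)).exists
  obtain ⟨T, hT, hTy⟩ := intermediate_value_Icc' hb0.le (h.conty.mono fun t ht => ht.1)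
    ⟨hb.le, h0.le⟩
  refine ⟨T, lt_of_le_of_ne hT.1 ?_, hTy⟩
  rintro rfl
  exact h0.ne' hTy

theorem le_U_of_slope (h : Profile lam β γ U y) (hl : 0 ≤ lam) (hβ : 0 ≤ β) (hγ : 10 ≤ γ)
    {T : ℝ} (hT : 0 ≤ T) (hy : y T = 3 / (2 * γ)) : γ - 6 / γ ≤ U T := by
  have h1 := h.sq_drop hl hβ hT hy.le
  refine abs_le_of_sq_le_sq' ?_ (h.Unonneg hT) |>.2
  refine le_trans ?_ h1
  have h2 : (6 / γ) * γ = 6 := by field_simp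
  have h3 : 6 / γ ≤ 1 := by rw [div_le_one (by positivity)]; linarith
  have h4 : 0 ≤ 6 / γ := by positivity
  nlinarith

theorem dens_slope_le (h : Profile lam β γ U y) (hl : 0 ≤ lam) (hβ : 0 ≤ β) (hγ : 10 ≤ γ)
    {T : ℝ} (hT : 0 < T) (hy : y T = 3 / (2 * γ)) : dens β U T ≤ 15 / γ ^ 2 := by
  have hγ0 : 0 < γ := by linarith
  have h1 := h.le_U_of_slope hl hβ hγ hT.le hy
  have h2 : 6 / γ ≤ 1 := by rw [div_le_one (by positivity)]; linarith
  have h3 : γ / 2 ≤ U T := by linarith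
  have h4 := h.lin_le_y hl hβ hT.le
  have h5 := h.pohozaev_upper hl hβ hT
  have h6 : lam * exp (-2 * T) * (γ / 2) ≤ lam * exp (-2 * T) * U T :=
    mul_le_mul_of_nonneg_left h3 (by positivity)
  have h7 : lam * γ * exp (-2 * T) ≤ 6 / γ := by
    have : 6 / γ = 4 * (3 / (2 * γ)) := by field_simp; norm_num
    rw [this, ← hy]; linarith
  have h8 : 2 / U T ≤ 4 / γ := by
    rw [div_le_div_iff₀ (by linarith) hγ0]; linarith
  have h9 : y T * (2 / U T + lam * γ * exp (-2 * T)) ≤ 3 / (2 * γ) * (4 / γ + 6 / γ) := by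
    rw [hy]
    exact mul_le_mul_of_nonneg_left (by linarith) (by positivity)
  have h10 : 3 / (2 * γ) * (4 / γ + 6 / γ) = 15 / γ ^ 2 := by field_simp; norm_num
  have h11 : 0 ≤ lam * exp (-2 * T) := by positivity
  nlinarith [sq_nonneg (y T)]

theorem exists_level (h : Profile lam β γ U y) (hγ : 10 ≤ γ) {T : ℝ} (hT : 0 ≤ T)
    (hU : γ - 6 / γ ≤ U T) : ∃ T₁, 0 ≤ T₁ ∧ T₁ ≤ T ∧ U T₁ = 5 / 6 * γ := by
  have h2 : 6 / γ ≤ 1 := by rw [div_le_one (by positivity)]; linarith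
  obtain ⟨s, hs, hsU⟩ := intermediate_value_Icc hT (h.contU.mono fun t ht => ht.1)
    (show 5 / 6 * γ ∈ Icc (U 0) (U T) by
      rw [h.U0]; exact ⟨by positivity, by linarith⟩)
  exact ⟨s, hs.1, hs.2, hsU⟩

/-- Between the levels `5γ/6` and `γ`, once the slope is at least `3 / (2γ)`, the nonlinear term
decays exponentially away from the origin. -/
theorem five_fourths_le (h : Profile lam β γ U y) (hl : 0 ≤ lam) (hβ : 0 ≤ β)
    {T₁ T t : ℝ} (hT₁ : 0 ≤ T₁) (hU : U T₁ = 5 / 6 * γ) (hy : y T = 3 / (2 * γ))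
    (h1 : T₁ ≤ t) (h2 : t ≤ T) : 5 / 4 ≤ U t * y t := by
  have hγ := h.gamma_pos hl hβ
  have h3 := h.U_mono hl hβ hT₁ h1
  have h4 := h.y_anti hl hβ (hT₁.trans h1) h2
  rw [hU] at h3
  rw [hy] at h4
  calc (5 : ℝ) / 4 = 5 / 6 * γ * (3 / (2 * γ)) := by field_simp; norm_num
    _ ≤ U t * y t := mul_le_mul h3 h4 (by positivity) (h.Unonneg (hT₁.trans h1))

theorem dens_le_exp (h : Profile lam β γ U y) (hl : 0 ≤ lam) (hβ : 0 ≤ β)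
    {T₁ T t : ℝ} (hT₁ : 0 ≤ T₁) (hU : U T₁ = 5 / 6 * γ) (hy : y T = 3 / (2 * γ))
    (h1 : T₁ ≤ t) (h2 : t ≤ T) : dens β U t ≤ dens β U T * exp (-((T - t) / 2)) := by
  have hc := h.continuousOn_dens
  have key : (fun s => dens β U s * exp (-s / 2)) t ≤ (fun s => dens β U s * exp (-s / 2)) T := by
    refine le_of_hasDerivAt_nonneg (by fun_prop) (fun s hs => (h.hasDerivAt_dens hs).mul
      (((hasDerivAt_id s).neg.div_const 2).exp)) (hT₁.trans h1) h2 ?_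
    intro s hs1 hs2
    have h3 := h.five_fourths_le hl hβ hT₁ hU hy (h1.trans hs1.le) hs2.le
    have h4 : 0 ≤ dens β U s * exp (-s / 2) := mul_nonneg (dens_nonneg hβ U s) (exp_pos _).le
    simp only [id, Pi.neg_apply]
    nlinarith
  simp only at key
  have h5 := mul_le_mul_of_nonneg_right key (exp_pos (t / 2)).le
  rw [mul_assoc, mul_assoc, ← exp_add, ← exp_add] at h5
  ring_nf at h5 ⊢
  simpa using h5

end Profile

/-- If `U` stays above `5γ/6` up to a fixed distance of the origin, the pairing with the
first eigenfunction is too large. -/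
theorem Pairing.level_bound {lam lam1 β γ v10 : ℝ} {U y V x a : ℝ → ℝ}
    (h : Profile lam β γ U y) (hV : Profile lam1 0 v10 V x)
    (ha : Pairing U V a) (hl : 0 ≤ lam) (hll : lam ≤ lam1) (hβ : 0 ≤ β) (hγ : 10 ≤ γ)
    {T₁ T t₁ : ℝ} (hT₁ : 0 ≤ T₁) (hTT : T₁ ≤ T) (hT : 0 < T) (hU : U T₁ = 5 / 6 * γ)
    (hy : y T = 3 / (2 * γ)) (ht : T₁ ≤ t₁) :
    (lam1 - lam) * (5 / 6 * γ * V t₁ * exp (-2 * t₁) / 2) ≤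
      v10 * (32 / γ + 15 / γ * exp (2 * t₁) * t₁) := by
  have hγ0 : 0 < γ := by linarith
  have hl1 := hl.trans hll
  have hv := hV.gamma_pos hl1 le_rfl
  have hE := h.dens_slope_le hl hβ hγ hT hy
  have hE1 : dens β U T₁ ≤ 15 / γ ^ 2 := by
    refine (h.dens_le_exp hl hβ hT₁ hU hy le_rfl hTT).trans ((mul_le_of_le_one_right
      (Profile.dens_nonneg hβ U T) (exp_le_one_iff.2 ?_)).trans hE)
    linarith
  have hc := Pairing.continuousOn_mass h hV ha (lam1 - lam)
  have hcd := h.continuousOn_dens (β := β)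
  have m1 : mass U y V x a (lam1 - lam) T₁ ≤ v10 * (32 / γ) := by
    have key : (fun s => mass U y V x a (lam1 - lam) s + 2 * γ * v10 * dens β U s) T₁ ≤
        (fun s => mass U y V x a (lam1 - lam) s + 2 * γ * v10 * dens β U s) T := by
      refine le_of_hasDerivAt_nonneg (by fun_prop) (fun s hs =>
        (Pairing.hasDerivAt_mass h hV ha hs).add ((h.hasDerivAt_dens hs).const_mul _)) hT₁ hTT ?_
      intro s hs1 hs2
      have h0 := hT₁.trans hs1.le
      have h3 := h.five_fourths_le hl hβ hT₁ hU hy hs1.le hs2.le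
      have h4 : U s * V s ≤ γ * v10 := mul_le_mul (h.U_le hl hβ h0)
          (hV.U_le hl1 le_rfl h0) (hV.Unonneg h0) hγ0.le
      have h5 := Profile.dens_nonneg hβ U s
      have h6 := mul_le_mul_of_nonneg_right h4 h5
      have h7 : 0 ≤ γ * v10 * dens β U s := by positivity
      nlinarith
    simp only at key
    have h1 := Pairing.mass_le h hV ha hl hl1 hβ hT.le
    rw [hy] at h1
    have h2 : 0 ≤ 2 * γ * v10 * dens β U T₁ :=
      mul_nonneg (by positivity) (Profile.dens_nonneg hβ U T₁)
    have h3 : 2 * γ * v10 * dens β U T ≤ 2 * γ * v10 * (15 / γ ^ 2) :=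
      mul_le_mul_of_nonneg_left hE (by positivity)
    have h4 : v10 * (3 / (2 * γ)) + 2 * γ * v10 * (15 / γ ^ 2) ≤ v10 * (32 / γ) := by
      have : v10 * (32 / γ) - (v10 * (3 / (2 * γ)) + 2 * γ * v10 * (15 / γ ^ 2)) =
        v10 / (2 * γ) := by field_simp; norm_num
      have : 0 ≤ v10 / (2 * γ) := by positivity
      linarith
    linarith
  have m0 := Pairing.mass_le_add h hV ha hl hl1 hβ le_rfl hT₁
    (δ := 15 / γ ^ 2 * exp (2 * t₁)) (by
      intro r h0 h1
      have h2 : dens β U r ≤ dens β U T₁ * exp (2 * (T₁ - r)) := by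
        rw [dens, dens, mul_assoc, ← exp_add]
        refine mul_le_mul_of_nonneg_left (exp_le_exp.2 ?_) hβ
        have := h.U_mono hl hβ h0.le h1.le
        have := pow_le_pow_left₀ (h.Unonneg h0.le) this 2
        linarith
      refine h2.trans (mul_le_mul hE1 (exp_le_exp.2 (by linarith)) (exp_pos _).le
        (by positivity)))
  rw [Pairing.mass_zero h hV] at m0
  have h1 := Pairing.le_pairing h hV ha hl hl1 hβ (hT₁.trans ht)
  have h2 := Pairing.anti h hV ha le_rfl (hT₁.trans ht)
  have h3 := h.U_mono hl hβ hT₁ ht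
  rw [hU] at h3
  have h4 : 5 / 6 * γ * V t₁ * exp (-2 * t₁) ≤ U t₁ * V t₁ * exp (-2 * t₁) :=
    mul_le_mul_of_nonneg_right (mul_le_mul_of_nonneg_right h3
      (hV.Unonneg (hT₁.trans ht))) (exp_pos _).le
  have h5 := mul_le_mul_of_nonneg_left (show 5 / 6 * γ * V t₁ * exp (-2 * t₁) / 2 ≤ a 0 by linarith)
    (sub_nonneg.2 hll)
  have h6 : v10 * γ * (15 / γ ^ 2 * exp (2 * t₁)) * (T₁ - 0) ≤
      v10 * γ * (15 / γ ^ 2 * exp (2 * t₁)) * t₁ :=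
    mul_le_mul_of_nonneg_left (by linarith) (by positivity)
  have h7 : v10 * γ * (15 / γ ^ 2 * exp (2 * t₁)) * t₁ =
      v10 * (15 / γ * exp (2 * t₁) * t₁) := by field_simp
  linarith

theorem Profile.slope_sub_level {lam β γ : ℝ} {U y : ℝ → ℝ} (h : Profile lam β γ U y)
    (hl : 0 ≤ lam) (hβ : 0 ≤ β) (hγ : 10 ≤ γ) {T₁ T : ℝ} (hT₁ : 0 ≤ T₁) (hTT : T₁ ≤ T)
    (hU : U T₁ = 5 / 6 * γ) (hUT : γ - 6 / γ ≤ U T) (hs : lam * exp (-2 * T₁) ≤ 1 / 12) :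
    γ ^ 2 / 100 ≤ T - T₁ := by
  have hγ0 : 0 < γ := by linarith
  have hc := h.contU
  have key : (fun s => U s - 3 / γ * s + lam * γ / 2 * exp (-2 * s)) T ≤
      (fun s => U s - 3 / γ * s + lam * γ / 2 * exp (-2 * s)) T₁ := by
    refine ge_of_hasDerivAt_nonpos (by fun_prop) (fun s hs => ((h.derU s hs).sub
      ((hasDerivAt_id s).const_mul _)).add ((hasDerivAt_exp_neg_two s).const_mul _)) hT₁ hTT ?_
    intro s hs1 hs2
    have h1 := h.y_le hl hβ (hT₁.trans_lt hs1)
    have h2 := h.U_mono hl hβ hT₁ hs1.le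
    rw [hU] at h2
    have h3 : 2 / U s ≤ 3 / γ := by
      rw [div_le_div_iff₀ (by linarith) hγ0]; linarith
    linarith
  simp only at key
  have h1 : 0 ≤ lam * γ / 2 * exp (-2 * T) := by positivity
  have h2 : lam * γ / 2 * exp (-2 * T₁) ≤ γ / 24 := by
    have := mul_le_mul_of_nonneg_left hs hγ0.le
    linarith
  have h3 : γ / 6 - 6 / γ - γ / 24 ≤ 3 / γ * (T - T₁) := by linarith
  have h4 : γ * (γ / 6 - 6 / γ - γ / 24) ≤ γ * (3 / γ * (T - T₁)) :=
    mul_le_mul_of_nonneg_left h3 hγ0.le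
  have h5 : γ * (3 / γ * (T - T₁)) = 3 * (T - T₁) := by field_simp
  have h6 : γ * (γ / 6 - 6 / γ - γ / 24) = γ ^ 2 / 8 - 6 := by field_simp; ring
  nlinarith

/-- `T` is a point in the neck region, where the nonlinear term has become negligible and
the slope of `U` is close to `2 / γ`. -/
structure Neck (β γ : ℝ) (U y : ℝ → ℝ) (T : ℝ) : Prop where
  T_ge : γ ^ 2 / 200 ≤ T
  y_ge : 3 / (2 * γ) ≤ y T
  y_le : y T ≤ 4 / γ
  U_ge : γ - 70 * (log γ / γ) ≤ U T
  dens_le : dens β U T ≤ 15 / γ ^ 10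
  log_ge : -(131 * log γ) ≤ log (dens β U T)
  y_lower : 2 / γ - 1 / γ ^ 8 ≤ y T
  y_upper : y T ≤ 2 / γ + 170 * (log γ / γ ^ 3)

theorem exp_neck_le {lam1 γ T : ℝ} (hl1 : 0 ≤ lam1)
    (hexp : (lam1 + 1) * exp (-(γ ^ 2 / 200)) ≤ 1 / γ ^ 20) (hT : γ ^ 2 / 200 ≤ T) :
    exp (-T) ≤ 1 / γ ^ 20 ∧ lam1 * exp (-2 * T) ≤ 1 / γ ^ 20 ∧ exp (-2 * T) ≤ 1 / γ ^ 20 := by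
  have h0 : exp (-T) ≤ exp (-(γ ^ 2 / 200)) := exp_le_exp.2 (by linarith)
  have h1 : exp (-2 * T) ≤ exp (-(γ ^ 2 / 200)) := exp_le_exp.2 (by nlinarith [sq_nonneg γ])
  have h2 := mul_le_mul_of_nonneg_left h1 hl1
  have h3 : 0 ≤ lam1 * exp (-(γ ^ 2 / 200)) := by positivity
  have h4 : 0 ≤ exp (-(γ ^ 2 / 200)) := by positivity
  refine ⟨?_, ?_, ?_⟩ <;> nlinarith

namespace Profile

variable {lam lam1 β γ : ℝ} {U y : ℝ → ℝ}

theorem neck_of_level (h : Profile lam β γ U y) (hl : 0 ≤ lam) (hll : lam ≤ lam1) (hβ : 0 ≤ β)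
    (hγ : 200 ≤ γ) (hlog : 70 * log γ ≤ γ)
    (hexp : (lam1 + 1) * exp (-(γ ^ 2 / 200)) ≤ 1 / γ ^ 20) {T₁ T₀ : ℝ} (hT₁ : 0 ≤ T₁)
    (hU : U T₁ = 5 / 6 * γ) (hy : y T₀ = 3 / (2 * γ)) (hTT : γ ^ 2 / 100 ≤ T₀ - T₁) :
    Neck β γ U y (T₀ - 16 * log γ) := by
  have hγ0 : 0 < γ := by linarith
  have hlog1 : 1 ≤ log γ := by
    rw [le_log_iff_exp_le hγ0]
    linarith [exp_one_lt_d9]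
  set T := T₀ - 16 * log γ with hTdef
  have hT1 : T₁ ≤ T := by nlinarith
  have hT : γ ^ 2 / 200 ≤ T := by nlinarith
  have hTpos : 0 < T := lt_of_lt_of_le (by positivity) hT
  have hT0 : T ≤ T₀ := by linarith
  obtain ⟨e0, e1, e2⟩ := exp_neck_le (hl.trans hll) hexp hT
  have hlamE : lam * exp (-2 * T) ≤ 1 / γ ^ 20 :=
    (mul_le_mul_of_nonneg_right hll (exp_pos _).le).trans e1
  have hUT := h.U_mono hl hβ hT₁ hT1
  rw [hU] at hUT
  have hyT : 3 / (2 * γ) ≤ y T := hy ▸ h.y_anti hl hβ hTpos.le hT0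
  have hyle := h.y_le hl hβ hTpos
  have hp19 : γ * (1 / γ ^ 20) = 1 / γ ^ 19 := by field_simp
  have hg : lam * γ * exp (-2 * T) ≤ 1 / γ ^ 19 := by
    have := mul_le_mul_of_nonneg_left hlamE hγ0.le
    linarith
  have h19 : 1 / γ ^ 19 ≤ 1 / γ ^ 3 * (1 / 2) := by
    have : 1 / γ ^ 19 = 1 / γ ^ 3 * (1 / γ ^ 16) := by field_simp
    rw [this]
    refine mul_le_mul_of_nonneg_left ?_ (by positivity)
    refine one_div_le_one_div_of_le (by norm_num) ?_
    exact le_trans (by linarith) (le_self_pow₀ (by linarith) (by norm_num : (16:ℕ) ≠ 0))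
  have h3 : 1 / γ ^ 3 ≤ 1 / γ :=
    one_div_le_one_div_of_le hγ0 (le_self_pow₀ (by linarith) (by norm_num))
  have h3p : 0 < 1 / γ ^ 3 := by positivity
  have hy4 : y T ≤ 4 / γ := by
    have : 2 / U T ≤ 3 / γ := by
      rw [div_le_div_iff₀ (by linarith) hγ0]; linarith
    have h4 : 4 / γ = 3 / γ + 1 / γ := by ring
    linarith
  have hU0 := h.le_U_of_slope hl hβ (by linarith) (hTpos.le.trans hT0) hy
  have hUge : γ - 70 * (log γ / γ) ≤ U T := by
    have hc := h.contU
    have key : (fun s => U s - 4 / γ * s) T₀ ≤ (fun s => U s - 4 / γ * s) T := by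
      refine ge_of_hasDerivAt_nonpos (by fun_prop) (fun s hs => (h.derU s hs).sub
        ((hasDerivAt_id s).const_mul _)) hTpos.le hT0 ?_
      intro s hs1 _
      have := h.y_anti hl hβ hTpos.le hs1.le
      linarith
    simp only at key
    have h5 : 4 / γ * T₀ - 4 / γ * T = 64 * (log γ / γ) := by rw [hTdef]; ring
    have h6 : 6 / γ ≤ 6 * (log γ / γ) := by
      rw [← mul_div_assoc]
      exact div_le_div_of_nonneg_right (by linarith) hγ0.le
    linarith
  have hdens0 := h.dens_slope_le hl hβ (by linarith) (hTpos.trans_le hT0) hy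
  have hdens : dens β U T ≤ 15 / γ ^ 10 := by
    refine (h.dens_le_exp hl hβ hT₁ hU hy hT1 hT0).trans ?_
    have h8 : exp (-((T₀ - T) / 2)) = 1 / γ ^ 8 := by
      rw [show -((T₀ - T) / 2) = -((8 : ℕ) * log γ) by rw [hTdef]; push_cast; ring, exp_neg,
        exp_nat_mul, exp_log hγ0, one_div]
    rw [h8]
    calc dens β U T₀ * (1 / γ ^ 8) ≤ 15 / γ ^ 2 * (1 / γ ^ 8) :=
          mul_le_mul_of_nonneg_right hdens0 (by positivity)
      _ = 15 / γ ^ 10 := by field_simp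
  have h20 : 1 / γ ^ 20 ≤ 1 / γ ^ 10 :=
    one_div_le_one_div_of_le (by positivity) (pow_le_pow_right₀ (by linarith) (by norm_num))
  refine ⟨hT, hyT, hy4, hUge, hdens, ?_, ?_, ?_⟩
  · have hlow : 1 / γ ^ 3 ≤ dens β U T₀ := by
      have h1 := h.pohozaev_lower hl hβ (hTpos.le.trans hT0)
      rw [hy] at h1
      have h2 : exp (-2 * T₀) ≤ exp (-2 * T) := exp_le_exp.2 (by linarith)
      have h4 := mul_le_mul_of_nonneg_left h2 hl
      have h5 : 3 / (2 * γ) * (2 / γ - 3 / (2 * γ)) = 3 / 4 * (1 / γ ^ 2) := by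
        field_simp; norm_num
      have h6 : 1 / γ ^ 3 = 1 / γ ^ 2 * (1 / γ) := by field_simp
      have h7 : 1 / γ ≤ 1 / 200 := one_div_le_one_div_of_le (by norm_num) hγ
      have h8 : 1 / γ ^ 10 ≤ 1 / γ ^ 3 :=
        one_div_le_one_div_of_le (by positivity) (pow_le_pow_right₀ (by linarith) (by norm_num))
      have h9 := mul_le_mul_of_nonneg_left h7 (show 0 ≤ 1 / γ ^ 2 by positivity)
      have h10 : 0 ≤ 1 / γ ^ 2 := by positivity
      linarith
    have hc := h.continuousOn_dens (β := β)
    have key : (fun s => dens β U s * exp (-8 * s)) T₀ ≤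
        (fun s => dens β U s * exp (-8 * s)) T := by
      refine ge_of_hasDerivAt_nonpos (by fun_prop) (fun s hs => (h.hasDerivAt_dens hs).mul
        (((hasDerivAt_id s).const_mul (-8)).exp)) hTpos.le hT0 ?_
      intro s hs1 _
      have h1 : U s * y s ≤ γ * (4 / γ) := mul_le_mul (h.U_le hl hβ (hTpos.le.trans hs1.le))
        ((h.y_anti hl hβ hTpos.le hs1.le).trans hy4)
        (h.y_nonneg hl hβ (hTpos.le.trans hs1.le)) hγ0.le
      rw [mul_div_cancel₀ _ hγ0.ne'] at h1
      have h2 : 0 ≤ dens β U s * exp (-8 * s) := mul_nonneg (dens_nonneg hβ U s) (exp_pos _).le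
      simp only [id]
      nlinarith
    simp only at key
    have h1 : 1 / γ ^ 3 * exp (-8 * T₀) ≤ dens β U T * exp (-8 * T) :=
      (mul_le_mul_of_nonneg_right hlow (exp_pos _).le).trans key
    have hpos : 0 < dens β U T := by
      by_contra! hc
      have : dens β U T * exp (-8 * T) ≤ 0 := mul_nonpos_of_nonpos_of_nonneg hc (exp_pos _).le
      have : 0 < 1 / γ ^ 3 * exp (-8 * T₀) := by positivity
      linarith
    have h2 := log_le_log (by positivity) h1
    rw [log_mul (by positivity) (by positivity), log_mul hpos.ne' (by positivity), log_exp,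
      log_exp, one_div, log_inv, log_pow] at h2
    push_cast at h2
    linarith
  · by_contra! hc
    have h1 := h.pohozaev_lower hl hβ hTpos.le
    have h2 : 3 / (2 * γ) * (1 / γ ^ 8) ≤ y T * (2 / γ - y T) :=
      mul_le_mul hyT (by linarith) (by positivity) (le_trans (by positivity) hyT)
    have h4 : 3 / (2 * γ) * (1 / γ ^ 8) = 3 / 2 * γ * (1 / γ ^ 10) := by field_simp
    have h5 : 15 / γ ^ 10 = 15 * (1 / γ ^ 10) := by ring
    have h6 : 0 < 1 / γ ^ 10 := by positivity
    have h7 : 300 * (1 / γ ^ 10) ≤ 3 / 2 * γ * (1 / γ ^ 10) :=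
      mul_le_mul_of_nonneg_right (by linarith) h6.le
    linarith
  · have h1 : 2 / U T ≤ 2 / γ + 168 * (log γ / γ ^ 3) := by
      have hUpos : 0 < U T := by linarith
      have h2 : 2 / U T - 2 / γ = 2 * (γ - U T) / (U T * γ) := by field_simp
      have h4 : 2 * (γ - U T) / (U T * γ) ≤ 2 * (70 * (log γ / γ)) / (5 / 6 * γ * γ) := by
        refine div_le_div₀ (by positivity) (by linarith) (by positivity) ?_
        exact mul_le_mul_of_nonneg_right hUT hγ0.le
      have h5 : 2 * (70 * (log γ / γ)) / (5 / 6 * γ * γ) = 168 * (log γ / γ ^ 3) := by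
        field_simp; norm_num
      linarith
    have h6 : 1 / γ ^ 3 ≤ log γ / γ ^ 3 := div_le_div_of_nonneg_right hlog1 (by positivity)
    linarith

theorem le_affine (h : Profile lam β γ U y) (hl : 0 ≤ lam) (hβ : 0 ≤ β) {t T : ℝ} (ht : 0 ≤ t)
    (htT : t ≤ T) : U t ≤ (U T - y T * T) + y T * t := by
  have hc := h.contU
  have key : (fun s => U s - y T * s) t ≤ (fun s => U s - y T * s) T := by
    refine le_of_hasDerivAt_nonneg (by fun_prop) (fun s hs => (h.derU s hs).sub
      ((hasDerivAt_id s).const_mul _)) ht htT ?_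
    intro s hs1 hs2
    have := h.y_anti hl hβ (ht.trans hs1.le) hs2.le
    linarith
  simp only at key
  linarith

theorem intercept_nonneg (h : Profile lam β γ U y) (hl : 0 ≤ lam) (hβ : 0 ≤ β) {T : ℝ}
    (hT : 0 ≤ T) : 0 ≤ U T - y T * T := by
  have := h.le_affine hl hβ le_rfl hT
  rw [h.U0] at this
  linarith

theorem neck_le (h : Profile lam β γ U y) (hl : 0 ≤ lam) (hβ : 0 ≤ β) {T : ℝ} (hT : 0 ≤ T)
    (hy : 3 / (2 * γ) ≤ y T) : T ≤ 2 / 3 * γ ^ 2 := by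
  have hγ := h.gamma_pos hl hβ
  have h1 := h.intercept_nonneg hl hβ hT
  have h2 := h.U_le hl hβ hT
  have h3 := mul_le_mul_of_nonneg_right hy hT
  have h4 : 3 / (2 * γ) * T ≤ γ := by linarith
  rw [div_mul_eq_mul_div, div_le_iff₀ (by positivity)] at h4
  linarith

theorem intercept_log (h : Profile lam β γ U y) (hl : 0 ≤ lam) (hβ : 0 < β) (hγ : 200 ≤ γ)
    {T : ℝ} (hN : Neck β γ U y T) :
    |(U T - y T * T) - log (1 / β) / γ| ≤ 400 * (log γ / γ) := by
  have hγ0 : 0 < γ := by linarith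
  have hT : 0 ≤ T := le_trans (by positivity) hN.T_ge
  have hlog1 : 1 ≤ log γ := by
    rw [le_log_iff_exp_le hγ0]
    linarith [exp_one_lt_d9]
  have hTle := h.neck_le hl hβ.le hT hN.y_ge
  have hU0 := h.Unonneg hT
  have hU1 := h.U_le hl hβ.le hT
  have hld : log (dens β U T) = log β + (U T ^ 2 - 2 * T) := by
    rw [dens, log_mul hβ.ne' (exp_pos _).ne', log_exp]
  have hld0 : log (dens β U T) ≤ 0 := by
    refine log_nonpos (dens_nonneg hβ.le U T) (hN.dens_le.trans ?_)
    rw [div_le_one (by positivity)]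
    exact le_trans (by linarith) (le_self_pow₀ (by linarith) (by norm_num : (10:ℕ) ≠ 0))
  have e1 : (U T - y T * T) - log (1 / β) / γ =
      U T / γ * (γ - U T) - (y T - 2 / γ) * T + log (dens β U T) / γ := by
    rw [hld, one_div, log_inv]
    field_simp
    ring
  have b1 : 0 ≤ U T / γ * (γ - U T) := mul_nonneg (by positivity) (by linarith)
  have b2 : U T / γ * (γ - U T) ≤ 70 * (log γ / γ) := by
    have : U T / γ ≤ 1 := (div_le_one hγ0).2 hU1
    have := mul_le_mul_of_nonneg_right this (show 0 ≤ γ - U T by linarith)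
    linarith [hN.U_ge]
  have b3 : log (dens β U T) / γ ≤ 0 := div_nonpos_of_nonpos_of_nonneg hld0 hγ0.le
  have b4 : -(131 * (log γ / γ)) ≤ log (dens β U T) / γ := by
    have := div_le_div_of_nonneg_right hN.log_ge hγ0.le
    have e : -(131 * log γ) / γ = -(131 * (log γ / γ)) := by ring
    linarith
  have b5 : |y T - 2 / γ| ≤ 170 * (log γ / γ ^ 3) := by
    rw [abs_le]
    refine ⟨?_, by linarith [hN.y_upper]⟩
    have h8 : 1 / γ ^ 8 ≤ log γ / γ ^ 3 :=
      div_le_div₀ (by linarith) hlog1 (by positivity)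
        (pow_le_pow_right₀ (by linarith) (by norm_num))
    have : 0 ≤ log γ / γ ^ 3 := by positivity
    linarith [hN.y_lower]
  have b6 : |(y T - 2 / γ) * T| ≤ 114 * (log γ / γ) := by
    rw [abs_mul, abs_of_nonneg hT]
    have e : 170 * (log γ / γ ^ 3) * (2 / 3 * γ ^ 2) = 340 / 3 * (log γ / γ) := by
      field_simp; norm_num
    have h9 : 0 ≤ log γ / γ := by positivity
    have := mul_le_mul b5 hTle hT (by positivity)
    linarith
  have b7 : 0 ≤ log γ / γ := by positivity
  rw [abs_le] at b6
  rw [e1, abs_le]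
  constructor <;> linarith [b6.1, b6.2]

theorem dens_le_neck (h : Profile lam β γ U y) (hl : 0 ≤ lam) (hβ : 0 ≤ β) (hγ : 200 ≤ γ)
    {T : ℝ} (hN : Neck β γ U y T) (hL : 71 * (log γ / γ) ≤ U T - y T * T) {t : ℝ} (ht : 0 ≤ t)
    (htT : t ≤ T) : dens β U t ≤ 15 / γ ^ 10 := by
  have hγ0 : 0 < γ := by linarith
  have hlog1 : 1 ≤ log γ := by
    rw [le_log_iff_exp_le hγ0]
    linarith [exp_one_lt_d9]
  refine le_trans ?_ hN.dens_le
  refine mul_le_mul_of_nonneg_left (exp_le_exp.2 ?_) hβ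
  have h1 := h.le_affine hl hβ ht htT
  have hU0 := h.Unonneg ht
  set L := U T - y T * T with hLdef
  have hy0 : 0 ≤ y T := le_trans (by positivity) hN.y_ge
  have h2 : U t ^ 2 ≤ (L + y T * t) ^ 2 := pow_le_pow_left₀ hU0 h1 2
  have h3 : 2 ≤ y T * (L + U T) := by
    have hρ : 1 / γ ≤ log γ / γ := div_le_div_of_nonneg_right hlog1 hγ0.le
    have h4 : γ + 1 / γ ≤ L + U T := by linarith [hN.U_ge]
    have h8 : 1 / γ ^ 8 ≤ 1 / γ := one_div_le_one_div_of_le hγ0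
      (le_self_pow₀ (by linarith) (by norm_num))
    have h20 : 0 ≤ 2 / γ - 1 / γ ^ 8 := by
      have : 2 / γ = 1 / γ + 1 / γ := by ring
      have : 0 < 1 / γ := by positivity
      linarith
    have h5 : (2 / γ - 1 / γ ^ 8) * (γ + 1 / γ) ≤ y T * (L + U T) :=
      mul_le_mul hN.y_lower h4 (by positivity) hy0
    have h6 : (2 / γ - 1 / γ ^ 8) * (γ + 1 / γ) =
        2 + (2 * (1 / γ ^ 2) - 1 / γ ^ 7 - 1 / γ ^ 9) := by field_simp; ring
    have h7 : 1 / γ ^ 7 ≤ 1 / γ ^ 2 := one_div_le_one_div_of_le (by positivity)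
      (pow_le_pow_right₀ (by linarith) (by norm_num))
    have h9 : 1 / γ ^ 9 ≤ 1 / γ ^ 2 := one_div_le_one_div_of_le (by positivity)
      (pow_le_pow_right₀ (by linarith) (by norm_num))
    linarith
  have h4 : U T ^ 2 - (L + y T * t) ^ 2 = (T - t) * (y T * (L + U T) + y T * (y T * t)) := by
    have : U T = L + y T * T := by rw [hLdef]; ring
    rw [this]; ring
  have h5 : 0 ≤ y T * (y T * t) := by positivity
  have h6 : (T - t) * 2 ≤ (T - t) * (y T * (L + U T) + y T * (y T * t)) :=
    mul_le_mul_of_nonneg_left (by linarith) (by linarith)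
  linarith

theorem eigen_neck {v10 : ℝ} {V x : ℝ → ℝ} (hV : Profile lam1 0 v10 V x) (hl1 : 0 ≤ lam1) {t : ℝ}
    (ht : 0 ≤ t) : x t ≤ lam1 * v10 * exp (-2 * t) / 2 ∧
      v10 - V t ≤ lam1 * v10 * exp (-2 * t) / 4 := by
  have hx : ∀ t, 0 ≤ t → x t ≤ lam1 * v10 * exp (-2 * t) / 2 := by
    intro t ht
    have hc := hV.conty
    have key : (fun s => x s - lam1 * v10 / 2 * exp (-2 * s)) t ≤ 0 := by
      refine le_lim_of_hasDerivAt_nonneg (by fun_prop)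
        (fun s hs => (hV.dery s hs).sub ((hasDerivAt_exp_neg_two s).const_mul _)) ?_ ht ?_
      · have := hV.limy.sub (tendsto_exp_neg_two.const_mul (lam1 * v10 / 2))
        simp only [mul_zero, sub_zero] at this
        exact this
      · intro s hs
        have h1 := mul_le_mul_of_nonneg_left (hV.U_le hl1 le_rfl (ht.trans hs.le))
          (show 0 ≤ lam1 * exp (-2 * s) by positivity)
        simp only [dens, zero_mul, add_zero]
        linarith
    simp only at key
    linarith
  refine ⟨hx t ht, ?_⟩
  have hc := hV.contU
  have key : v10 ≤ (fun s => V s + lam1 * v10 / 4 * exp (-2 * s)) t := by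
    refine lim_le_of_hasDerivAt_nonpos (by fun_prop)
      (fun s hs => (hV.derU s hs).add ((hasDerivAt_exp_neg_two s).const_mul _)) ?_ ht ?_
    · have := hV.limU.add (tendsto_exp_neg_two.const_mul (lam1 * v10 / 4))
      simp only [mul_zero, add_zero] at this
      exact this
    · intro s hs
      have := hx s (ht.trans hs.le)
      linarith
  simp only at key
  linarith

end Profile

namespace Pairing

variable {lam lam1 β γ v10 : ℝ} {U y V x a : ℝ → ℝ}

theorem neck_lower (h : Profile lam β γ U y) (hV : Profile lam1 0 v10 V x) (ha : Pairing U V a)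
    (hl : 0 ≤ lam) (hll : lam ≤ lam1) (hβ : 0 ≤ β) (hγ : 200 ≤ γ)
    (hexp : (lam1 + 1) * exp (-(γ ^ 2 / 200)) ≤ 1 / γ ^ 20) {T : ℝ} (hN : Neck β γ U y T) :
    v10 * (2 / γ - 3 / γ ^ 2) ≤ (lam1 - lam) * a 0 := by
  have hγ0 : 0 < γ := by linarith
  have hl1 := hl.trans hll
  have hT : 0 ≤ T := le_trans (by positivity) hN.T_ge
  have hv := hV.gamma_pos hl1 le_rfl
  obtain ⟨e0, e1, e2⟩ := exp_neck_le hl1 hexp hN.T_ge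
  have hlamE : lam * exp (-2 * T) ≤ 1 / γ ^ 20 :=
    (mul_le_mul_of_nonneg_right hll (exp_pos _).le).trans e1
  have h1 := le_mass h hV ha hl hl1 hβ hT
  have h2 := mass_anti h hV ha hβ le_rfl hT
  rw [mass_zero h hV] at h2
  have h3 := (hV.eigen_neck hl1 hT).2
  have p20 : 1 / γ ^ 20 ≤ 1 / γ ^ 3 := one_div_le_one_div_of_le (by positivity)
    (pow_le_pow_right₀ (by linarith) (by norm_num))
  have h4 : v10 * (1 - 1 / γ) ≤ V T := by
    have p : 1 / γ ^ 20 ≤ 1 / γ := one_div_le_one_div_of_le (by positivity)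
      (le_self_pow₀ (by linarith) (by norm_num))
    have : v10 * (lam1 * exp (-2 * T)) ≤ v10 * (1 / γ) :=
      mul_le_mul_of_nonneg_left (e1.trans p) hv.le
    have : 0 ≤ v10 * (1 / γ) := by positivity
    linarith
  have q : γ * (1 / γ ^ 3) = 1 / γ ^ 2 := by field_simp
  have h7 : 1 / γ ≤ 1 / 200 := one_div_le_one_div_of_le (by norm_num) hγ
  have h6 : 0 ≤ 2 / γ - 1 / γ ^ 2 - 1 / γ ^ 2 := by
    have : 2 / γ - 1 / γ ^ 2 - 1 / γ ^ 2 = 2 * (1 / γ) * (1 - 1 / γ) := by field_simp; ring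
    rw [this]
    have : 0 < 1 / γ := by positivity
    exact mul_nonneg (by positivity) (by linarith)
  have h8 : v10 * (1 - 1 / γ) * (2 / γ - 1 / γ ^ 2) ≤ V T * (y T - lam * γ * exp (-2 * T) / 2) := by
    refine mul_le_mul h4 ?_ ?_ (hV.Unonneg hT)
    · have := mul_le_mul_of_nonneg_left (hlamE.trans p20) hγ0.le
      rw [q] at this
      have q8 : 1 / γ ^ 8 ≤ 1 / γ ^ 2 * (1 / 2) := by
        have : 1 / γ ^ 8 = 1 / γ ^ 2 * (1 / γ ^ 6) := by field_simp
        rw [this]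
        refine mul_le_mul_of_nonneg_left (one_div_le_one_div_of_le (by norm_num) ?_) (by positivity)
        exact le_trans (by linarith) (le_self_pow₀ (by linarith) (by norm_num : (6:ℕ) ≠ 0))
      linarith [hN.y_lower]
    · have : 0 ≤ 1 / γ ^ 2 := by positivity
      linarith
  have h9 : v10 * (2 / γ - 3 / γ ^ 2) ≤ v10 * (1 - 1 / γ) * (2 / γ - 1 / γ ^ 2) := by
    rw [mul_assoc]
    refine mul_le_mul_of_nonneg_left ?_ hv.le
    have : (1 - 1 / γ) * (2 / γ - 1 / γ ^ 2) - (2 / γ - 3 / γ ^ 2) = 1 / γ ^ 3 := by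
      field_simp; ring
    have : 0 < 1 / γ ^ 3 := by positivity
    linarith
  linarith

theorem neck_upper (h : Profile lam β γ U y) (hV : Profile lam1 0 v10 V x) (ha : Pairing U V a)
    (hl : 0 ≤ lam) (hll : lam ≤ lam1) (hβ : 0 ≤ β) (hγ : 200 ≤ γ) (hlog : 70 * log γ ≤ γ)
    {T : ℝ} (hN : Neck β γ U y T) (hL : 71 * (log γ / γ) ≤ U T - y T * T) :
    (lam1 - lam) * a 0 ≤ v10 * (2 / γ + 4 / γ ^ 2) := by
  have hγ0 : 0 < γ := by linarith
  have hl1 := hl.trans hll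
  have hT : 0 ≤ T := le_trans (by positivity) hN.T_ge
  have hv := hV.gamma_pos hl1 le_rfl
  have h1 := mass_le_add h hV ha hl hl1 hβ le_rfl hT
    fun r h1 h2 => h.dens_le_neck hl hβ hγ hN hL h1.le h2.le
  have h2 := mass_le h hV ha hl hl1 hβ hT
  rw [mass_zero h hV] at h1
  have h3 := h.neck_le hl hβ hT hN.y_ge
  have h4 : v10 * γ * (15 / γ ^ 10) * (T - 0) ≤ v10 * γ * (15 / γ ^ 10) * (2 / 3 * γ ^ 2) :=
    mul_le_mul_of_nonneg_left (by linarith) (by positivity)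
  have h5 : v10 * γ * (15 / γ ^ 10) * (2 / 3 * γ ^ 2) = v10 * (10 * (1 / γ ^ 7)) := by
    field_simp; norm_num
  have h6 : 10 * (1 / γ ^ 7) ≤ 1 / γ ^ 2 := by
    have : 1 / γ ^ 7 = 1 / γ ^ 2 * (1 / γ ^ 5) := by field_simp
    rw [this]
    have : 1 / γ ^ 5 ≤ 1 / 10 := one_div_le_one_div_of_le (by norm_num)
      (le_trans (by linarith) (le_self_pow₀ (by linarith) (by norm_num : (5:ℕ) ≠ 0)))
    have := mul_le_mul_of_nonneg_left this (show 0 ≤ 1 / γ ^ 2 by positivity)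
    linarith
  have h7 : 170 * (log γ / γ ^ 3) ≤ 3 / γ ^ 2 := by
    have : 170 * (log γ / γ ^ 3) = 170 * log γ / γ * (1 / γ ^ 2) := by field_simp
    rw [this, show 3 / γ ^ 2 = 3 * (1 / γ ^ 2) by ring]
    refine mul_le_mul_of_nonneg_right ?_ (by positivity)
    rw [div_le_iff₀ hγ0]
    linarith
  have h8 : v10 * y T ≤ v10 * (2 / γ + 3 / γ ^ 2) :=
    mul_le_mul_of_nonneg_left (by linarith [hN.y_upper]) hv.le
  have h9 := mul_le_mul_of_nonneg_left h6 hv.le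
  have h10 : v10 * (2 / γ + 4 / γ ^ 2) = v10 * (2 / γ + 3 / γ ^ 2) + v10 * (1 / γ ^ 2) := by ring
  linarith

theorem intercept_lower (h : Profile lam β γ U y) (hV : Profile lam1 0 v10 V x)
    (ha : Pairing U V a) (hl : 0 ≤ lam) (hll : lam ≤ lam1) (hβ : 0 ≤ β) (hγ : 200 ≤ γ)
    (hexp : (lam1 + 1) * exp (-(γ ^ 2 / 200)) ≤ 1 / γ ^ 20) {T : ℝ} (hN : Neck β γ U y T) :
    2 * a 0 ≤ v10 * ((U T - y T * T) + 3 / γ) := by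
  have hγ0 : 0 < γ := by linarith
  have hl1 := hl.trans hll
  have hT : 0 ≤ T := le_trans (by positivity) hN.T_ge
  have hv := hV.gamma_pos hl1 le_rfl
  have h1 := pairing_zero_le h hV ha hl hl1 hβ hT (h.intercept_nonneg hl hβ hT)
    (le_trans (by positivity) hN.y_ge) fun t h1 h2 => h.le_affine hl hβ h1.le h2.le
  obtain ⟨e0, e1, e2⟩ := exp_neck_le hl1 hexp hN.T_ge
  have p20 : 1 / γ ^ 20 ≤ 1 / γ ^ 2 := one_div_le_one_div_of_le (by positivity)
    (pow_le_pow_right₀ (by linarith) (by norm_num))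
  have h2 : γ * v10 * exp (-2 * T) ≤ γ * v10 * (1 / γ ^ 2) :=
    mul_le_mul_of_nonneg_left (e2.trans p20) (by positivity)
  have h3 : γ * v10 * (1 / γ ^ 2) = v10 * (1 / γ) := by field_simp
  have h4 := mul_le_mul_of_nonneg_left hN.y_le hv.le
  have h5 : v10 * (4 / γ) = 4 * (v10 * (1 / γ)) := by ring
  have h6 : v10 * ((U T - y T * T) + 3 / γ) =
    v10 * (U T - y T * T) + 3 * (v10 * (1 / γ)) := by ring
  linarith

end Pairing

/-! ### Comparison with a multiple of the first eigenfunction -/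

/-- Backward Gronwall inequality for a pair of functions on `[0, T]`. -/
theorem abs_le_of_backward_gronwall {p q p' q' : ℝ → ℝ} {T K α c f : ℝ} (hK : 0 ≤ K)
    (hc : 0 ≤ c) (hcα : c < α) (hf : 0 ≤ f) (hpc : ContinuousOn p (Ici 0))
    (hqc : ContinuousOn q (Ici 0)) (hp : ∀ t, 0 < t → HasDerivAt p (p' t) t)
    (hq : ∀ t, 0 < t → HasDerivAt q (q' t) t) (hpT : |p T| ≤ α) (hqT : |q T| ≤ α)
    (hb : ∀ t N, 0 < t → t ≤ T → |p t| ≤ N → |q t| ≤ N →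
      |p' t| ≤ K * exp (-t) * N + c * exp (-t) + f ∧
      |q' t| ≤ K * exp (-t) * N + c * exp (-t) + f) {t : ℝ} (ht : 0 ≤ t) (htT : t ≤ T) :
    |p t| ≤ exp (K + 1) * (α + f * T) ∧ |q t| ≤ exp (K + 1) * (α + f * T) := by
  have hα : 0 < α := hc.trans_lt hcα
  set F : ℝ → ℝ × ℝ := fun s => (p (T - s), q (T - s)) with hF
  set B : ℝ → ℝ := fun s => exp ((K + 1) * exp (s - T)) * (α + f * s) with hB
  have hmaps : MapsTo (fun s => T - s) (Icc 0 T) (Ici 0) := fun s hs => sub_nonneg.2 hs.2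
  have hsub : ContinuousOn (fun s => T - s) (Icc 0 T) := by fun_prop
  have key : ∀ ⦃s⦄, s ∈ Icc 0 T → ‖F s‖ ≤ B s := by
    refine image_norm_le_of_norm_deriv_right_lt_deriv_boundary
      (f' := fun s => (p' (T - s) * (-1), q' (T - s) * (-1)))
      (B' := fun s => exp ((K + 1) * exp (s - T)) * ((K + 1) * exp (s - T)) * (α + f * s) +
        exp ((K + 1) * exp (s - T)) * f) ?_ ?_ ?_ ?_ ?_
    · exact (hpc.comp hsub hmaps).prodMk (hqc.comp hsub hmaps)
    · intro s hs
      have hs' : 0 < T - s := sub_pos.2 hs.2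
      have hd : HasDerivAt (fun s => T - s) (-1) s := by
        simpa using (hasDerivAt_id s).const_sub T
      exact (((hp _ hs').comp s hd).prodMk ((hq _ hs').comp s hd)).hasDerivWithinAt
    · have h1 : α ≤ B 0 := by
        simp only [hB, mul_zero, add_zero]
        exact le_mul_of_one_le_left hα.le (one_le_exp (by positivity))
      rw [Prod.norm_def]
      simp only [hF, sub_zero, Real.norm_eq_abs]
      exact max_le (hpT.trans h1) (hqT.trans h1)
    · intro s
      have h1 := ((((hasDerivAt_id s).sub_const T).exp).const_mul (K + 1)).exp
      have h2 := ((hasDerivAt_id s).const_mul f).const_add α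
      refine (h1.mul h2).congr_deriv ?_
      simp only [id]
      ring
    · intro s hs hN
      have hs' : 0 < T - s := sub_pos.2 hs.2
      rw [Prod.norm_def] at hN
      simp only [hF, Real.norm_eq_abs] at hN
      obtain ⟨b1, b2⟩ := hb (T - s) (B s) hs' (by linarith [hs.1])
        ((le_max_left _ _).trans hN.le) ((le_max_right _ _).trans hN.le)
      rw [neg_sub] at b1 b2
      have hE : 1 ≤ exp ((K + 1) * exp (s - T)) := one_le_exp (by positivity)
      have h1 : α ≤ B s := by
        have h2 : 0 ≤ f * s := mul_nonneg hf hs.1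
        have : α * 1 ≤ (α + f * s) * exp ((K + 1) * exp (s - T)) :=
          mul_le_mul (by linarith) hE zero_le_one (by linarith)
        simp only [hB]
        linarith
      have h2 : c * exp (s - T) < B s * exp (s - T) :=
        mul_lt_mul_of_pos_right (hcα.trans_le h1) (exp_pos _)
      have h3 : 1 * f ≤ exp ((K + 1) * exp (s - T)) * f := mul_le_mul_of_nonneg_right hE hf
      have h4 : K * exp (s - T) * B s + c * exp (s - T) + f <
          exp ((K + 1) * exp (s - T)) * ((K + 1) * exp (s - T)) * (α + f * s) +
            exp ((K + 1) * exp (s - T)) * f := by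
        have : exp ((K + 1) * exp (s - T)) * ((K + 1) * exp (s - T)) * (α + f * s) =
          K * exp (s - T) * B s + B s * exp (s - T) := by simp only [hB]; ring
        linarith
      rw [Prod.norm_def]
      simp only [mul_neg, mul_one, norm_neg, Real.norm_eq_abs]
      exact (max_le b1 b2).trans_lt h4
  have h1 := key (show T - t ∈ Icc 0 T from ⟨by linarith, by linarith⟩)
  rw [Prod.norm_def] at h1
  simp only [hF, Real.norm_eq_abs, sub_sub_cancel] at h1
  have h2 : B (T - t) ≤ exp (K + 1) * (α + f * T) := by
    simp only [hB]
    have e1 : exp (T - t - T) ≤ 1 := exp_le_one_iff.2 (by linarith)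
    have e2 : (K + 1) * exp (T - t - T) ≤ K + 1 := mul_le_of_le_one_right (by linarith) e1
    have e3 : f * (T - t) ≤ f * T := mul_le_mul_of_nonneg_left (by linarith) hf
    have e4 : 0 ≤ f * (T - t) := mul_nonneg hf (by linarith)
    exact mul_le_mul (exp_le_exp.2 e2) (by linarith) (by linarith) (exp_pos _).le
  exact ⟨(le_max_left _ _).trans (h1.trans h2), (le_max_right _ _).trans (h1.trans h2)⟩

theorem one_add_sq_le_exp {t : ℝ} (ht : 0 ≤ t) : (1 + t) ^ 2 ≤ 4 * exp t := by
  have h1 : 1 + t ≤ 2 * exp (t / 2) := by linarith [add_one_le_exp (t / 2)]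
  have h2 : exp t = exp (t / 2) ^ 2 := by rw [← exp_nat_mul]; push_cast; ring_nf
  rw [h2]
  nlinarith [exp_pos (t / 2)]

theorem one_add_mul_le {lam1 κ L γ s N z : ℝ} (hγ : 200 ≤ γ) (hl1 : 0 ≤ lam1) (hκ : 0 ≤ κ)
    (hL : 0 ≤ L) (hN : 0 ≤ N) (hs : 0 ≤ s) (hsγ : 1 + s ≤ γ ^ 2)
    (hz : z ≤ lam1 * exp (-2 * s) * ((2 + s) * N) + exp (-2 * s) * (lam1 * (4 / γ * s)) +
        exp (-2 * s) * (κ / γ * (L + 4 / γ * s)) + 15 / γ ^ 9) :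
    (1 + s) * z ≤ 8 * lam1 * exp (-s) * N +
      (16 * lam1 + 16 * κ + κ * L) / γ * exp (-s) + 15 / γ ^ 7 := by
  have hγ0 : 0 < γ := by linarith
  refine (mul_le_mul_of_nonneg_left hz (by linarith)).trans ?_
  have he : exp (-2 * s) = exp (-s) * exp (-s) := by rw [← exp_add]; ring_nf
  have hes : exp (-s) * exp s = 1 := by rw [← exp_add]; simp
  have hE : (1 + s) ^ 2 * exp (-2 * s) ≤ 4 * exp (-s) := by
    have := mul_le_mul_of_nonneg_right (one_add_sq_le_exp hs) (exp_pos (-2 * s)).le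
    rw [he] at this ⊢
    have e : 4 * exp s * (exp (-s) * exp (-s)) = 4 * exp (-s) * (exp (-s) * exp s) := by ring
    rw [e, hes, mul_one] at this
    exact this
  have hE0 := exp_pos (-2 * s)
  have c1 : (1 + s) * (lam1 * exp (-2 * s) * ((2 + s) * N)) ≤ 8 * lam1 * exp (-s) * N := by
    have h0 : (1 + s) * (2 + s) * exp (-2 * s) ≤ 2 * (1 + s) ^ 2 * exp (-2 * s) :=
      mul_le_mul_of_nonneg_right (by nlinarith) hE0.le
    have := mul_le_mul_of_nonneg_left (show (1 + s) * (2 + s) * exp (-2 * s) ≤ 8 * exp (-s) by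
      linarith) (mul_nonneg hl1 hN)
    linarith
  have hE1 : (1 + s) * s * exp (-2 * s) ≤ 4 * exp (-s) :=
    (mul_le_mul_of_nonneg_right (by nlinarith) hE0.le).trans hE
  have hE2 : (1 + s) * exp (-2 * s) ≤ exp (-s) := by
    have := mul_le_mul_of_nonneg_right (add_one_le_exp s) (exp_pos (-2 * s)).le
    have e : exp s * exp (-2 * s) = exp (-s) * (exp (-s) * exp s) := by rw [he]; ring
    rw [e, hes] at this
    linarith
  have c2 : (1 + s) * (exp (-2 * s) * (lam1 * (4 / γ * s))) ≤ 16 * lam1 / γ * exp (-s) := by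
    have := mul_le_mul_of_nonneg_left hE1 (by positivity : 0 ≤ lam1 * (4 / γ))
    have e : lam1 * (4 / γ) * (4 * exp (-s)) = 16 * lam1 / γ * exp (-s) := by ring
    linarith
  have c3 : (1 + s) * (exp (-2 * s) * (κ / γ * (L + 4 / γ * s))) ≤
      (16 * κ + κ * L) / γ * exp (-s) := by
    have d1 := mul_le_mul_of_nonneg_left hE2 (by positivity : 0 ≤ κ / γ * L)
    have d2 := mul_le_mul_of_nonneg_left hE1 (by positivity : 0 ≤ κ / γ * (4 / γ))
    have d3 : κ / γ * (4 / γ) * (4 * exp (-s)) ≤ κ / γ * 4 * (4 * exp (-s)) := by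
      gcongr
      rw [div_le_iff₀ hγ0]
      linarith
    have e : (16 * κ + κ * L) / γ * exp (-s) = κ / γ * 4 * (4 * exp (-s)) +
      κ / γ * L * exp (-s) := by ring
    linarith
  have c4 : (1 + s) * (15 / γ ^ 9) ≤ 15 / γ ^ 7 := by
    have : (1 + s) * (15 / γ ^ 9) ≤ γ ^ 2 * (15 / γ ^ 9) :=
      mul_le_mul_of_nonneg_right hsγ (by positivity)
    have e : γ ^ 2 * (15 / γ ^ 9) = 15 / γ ^ 7 := by field_simp
    linarith
  have e : (16 * lam1 + 16 * κ + κ * L) / γ * exp (-s) =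
    16 * lam1 / γ * exp (-s) + (16 * κ + κ * L) / γ * exp (-s) := by ring
  linarith

/-- The constant in the comparison of `U` with a multiple of the first eigenfunction. -/
def compConst (lam1 κ : ℝ) : ℝ := exp (8 * lam1 + 1) * (16 * lam1 + 17 * κ + 2) + 4

namespace Profile

variable {lam lam1 β γ κ v10 : ℝ} {U y V x : ℝ → ℝ}

set_option maxHeartbeats 1600000 in
theorem abs_sub_le (h : Profile lam β γ U y) (hV : Profile lam1 0 v10 V x) (hl : 0 ≤ lam)
    (hκ : 0 ≤ κ) (hε : lam1 - lam = κ / γ) (hβ : 0 ≤ β) (hγ : 200 ≤ γ)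
    (hexp : (lam1 + 1) * exp (-(γ ^ 2 / 200)) ≤ 1 / γ ^ 20) {T : ℝ} (hN : Neck β γ U y T)
    (hL : 71 * (log γ / γ) ≤ U T - y T * T) {t : ℝ} (ht : 0 ≤ t) (htT : t ≤ T) :
    |U t - (U T - y T * T) / v10 * V t| ≤
      compConst lam1 κ * (1 + (U T - y T * T)) / γ * (2 + t) := by
  have hγ0 : 0 < γ := by linarith
  have hll : lam ≤ lam1 := by
    have : 0 ≤ κ / γ := by positivity
    linarith
  have hl1 := hl.trans hll
  have hT : 0 ≤ T := le_trans (by positivity) hN.T_ge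
  have hv := hV.gamma_pos hl1 le_rfl
  have hL0 := h.intercept_nonneg hl hβ hT
  have hUle : ∀ t, 0 ≤ t → t ≤ T → U t ≤ (U T - y T * T) + 4 / γ * t := by
    intro t ht htT
    have := mul_le_mul_of_nonneg_right hN.y_le ht
    linarith [h.le_affine hl hβ ht htT]
  have hdens : ∀ t, 0 ≤ t → t ≤ T → dens β U t ≤ 15 / γ ^ 10 :=
    fun t ht htT => h.dens_le_neck hl hβ hγ hN hL ht htT
  obtain ⟨e0, e1, e2⟩ := exp_neck_le hl1 hexp hN.T_ge
  obtain ⟨n1, n2⟩ := hV.eigen_neck hl1 hT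
  have hTle := h.neck_le hl hβ hT hN.y_ge
  have hc0 : 0 ≤ y T := le_trans (by positivity) hN.y_ge
  have hc4 := hN.y_le
  have hxT := hV.y_nonneg hl1 le_rfl hT
  have hVT := hV.U_le hl1 le_rfl hT
  set L := U T - y T * T with hLdef
  set c := y T with hcdef
  set k := L / v10 with hk
  have hkv : k * v10 = L := div_mul_cancel₀ _ hv.ne'
  have hk0 : 0 ≤ k := div_nonneg hL0 hv.le
  set D : ℝ → ℝ := fun t => U t - k * V t - c * t with hD
  set q : ℝ → ℝ := fun t => y t - k * x t - c with hq
  set p : ℝ → ℝ := fun t => D t - (1 + t) * q t with hp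
  set q' : ℝ → ℝ := fun t => -(U t * (lam * exp (-2 * t) + dens β U t)) +
    k * (V t * (lam1 * exp (-2 * t))) with hq'
  have cU := h.contU
  have cy := h.conty
  have cV := hV.contU
  have cx := hV.conty
  have dq : ∀ t, 0 < t → HasDerivAt q (q' t) t := by
    intro t ht
    refine (((h.dery t ht).sub ((hV.dery t ht).const_mul k)).sub_const c).congr_deriv ?_
    simp only [hq', dens, zero_mul]
    ring
  have dD : ∀ t, 0 < t → HasDerivAt D (q t) t := by
    intro t ht
    refine (((h.derU t ht).sub ((hV.derU t ht).const_mul k)).sub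
      ((hasDerivAt_id t).const_mul c)).congr_deriv ?_
    simp only [hq]
    ring
  have dp : ∀ t, 0 < t → HasDerivAt p (-((1 + t) * q' t)) t := by
    intro t ht
    refine ((dD t ht).sub (((hasDerivAt_id t).const_add 1).mul (dq t ht))).congr_deriv ?_
    simp only [id]
    ring
  have hDpq : ∀ t, D t = p t + (1 + t) * q t := fun t => by simp only [hp]; ring
  have hcc : 0 ≤ 16 * lam1 + 16 * κ + κ * L := by positivity
  have hkx : k * x T ≤ L * (1 / γ ^ 20) := by
    have h1 := mul_le_mul_of_nonneg_left n1 hk0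
    have h2 : k * (lam1 * v10 * exp (-2 * T) / 2) = L * (lam1 * exp (-2 * T)) / 2 := by
      rw [← hkv]; ring
    have h3 := mul_le_mul_of_nonneg_left e1 hL0
    have h4 : 0 ≤ L * (1 / γ ^ 20) := by positivity
    linarith
  have hkV : k * (v10 - V T) ≤ L * (1 / γ ^ 20) := by
    have h1 := mul_le_mul_of_nonneg_left n2 hk0
    have h2 : k * (lam1 * v10 * exp (-2 * T) / 4) = L * (lam1 * exp (-2 * T)) / 4 := by
      rw [← hkv]; ring
    have h3 := mul_le_mul_of_nonneg_left e1 hL0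
    have h4 : 0 ≤ L * (1 / γ ^ 20) := by positivity
    linarith
  have hqT : |q T| = k * x T := by
    have : q T = -(k * x T) := by simp only [hq]; ring
    rw [this, abs_neg, abs_of_nonneg (mul_nonneg hk0 hxT)]
  have hDT : |D T| = k * (v10 - V T) := by
    have : D T = k * (v10 - V T) := by
      have : D T = L - k * V T := by simp only [hD, hLdef]; ring
      rw [this, mul_sub, hkv]
    rw [this, abs_of_nonneg (mul_nonneg hk0 (by linarith))]
  have hsmall : (2 + T) * (L * (1 / γ ^ 20)) ≤ (16 * lam1 + 16 * κ + κ * L + L + 1) / γ := by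
    have h1 : L / γ ≤ (16 * lam1 + 16 * κ + κ * L + L + 1) / γ :=
      div_le_div_of_nonneg_right (by linarith) hγ0.le
    have h2 : (2 + T) * (L * (1 / γ ^ 20)) ≤ γ ^ 2 * (L * (1 / γ ^ 20)) :=
      mul_le_mul_of_nonneg_right (by nlinarith only [hγ, hTle]) (by positivity)
    have h3 : γ ^ 2 * (L * (1 / γ ^ 20)) = L / γ ^ 18 := by field_simp
    have h4 : L / γ ^ 18 ≤ L / γ := div_le_div_of_nonneg_left hL0 hγ0
      (le_self_pow₀ (by linarith) (by norm_num))
    linarith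
  have hsmall0 : 0 ≤ L * (1 / γ ^ 20) := by positivity
  have gron := abs_le_of_backward_gronwall (p := p) (q := q) (p' := fun t => -((1 + t) * q' t))
    (q' := q') (T := T) (K := 8 * lam1) (α := (16 * lam1 + 16 * κ + κ * L + L + 1) / γ)
    (c := (16 * lam1 + 16 * κ + κ * L) / γ) (f := 15 / γ ^ 7) (by positivity)
    (by positivity) (div_lt_div_of_pos_right (by linarith) hγ0) (by positivity)
    (by simp only [hp, hD, hq]; fun_prop) (by simp only [hq]; fun_prop) dp dq ?_ ?_ ?_ ht htT
  · have hDt : |D t| ≤ (2 + t) * (exp (8 * lam1 + 1) *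
        ((16 * lam1 + 16 * κ + κ * L + L + 1) / γ + 15 / γ ^ 7 * T)) := by
      rw [hDpq t]
      refine (abs_add_le _ _).trans ?_
      rw [abs_mul, abs_of_nonneg (by linarith : 0 ≤ 1 + t)]
      have := mul_le_mul_of_nonneg_left gron.2 (by linarith : 0 ≤ 1 + t)
      linarith [gron.1]
    have h7 : 15 / γ ^ 7 * T ≤ 1 / γ := by
      have := mul_le_mul_of_nonneg_left hTle (show 0 ≤ 15 / γ ^ 7 by positivity)
      have e : 15 / γ ^ 7 * (2 / 3 * γ ^ 2) = 10 / γ ^ 5 := by field_simp; norm_num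
      have : 10 / γ ^ 5 ≤ 1 / γ := by
        rw [div_le_div_iff₀ (by positivity) hγ0]
        have : γ ^ 5 = γ * γ ^ 4 := by ring
        have : γ * 10 ≤ γ * γ ^ 4 := mul_le_mul_of_nonneg_left (le_trans (by linarith)
          (le_self_pow₀ (by linarith) (by norm_num : (4:ℕ) ≠ 0))) hγ0.le
        linarith
      linarith
    have h8 : (16 * lam1 + 16 * κ + κ * L + L + 1) / γ + 15 / γ ^ 7 * T ≤
        (16 * lam1 + 17 * κ + 2) * (1 + L) / γ := by
      have e : (16 * lam1 + 16 * κ + κ * L + L + 1) / γ + 1 / γ =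
        (16 * lam1 + 16 * κ + κ * L + L + 2) / γ := by ring
      have : (16 * lam1 + 16 * κ + κ * L + L + 2) / γ ≤
          (16 * lam1 + 17 * κ + 2) * (1 + L) / γ := by
        refine div_le_div_of_nonneg_right ?_ hγ0.le
        have : 0 ≤ lam1 * L := by positivity
        have : 0 ≤ κ * L := by positivity
        linarith
      linarith
    have h9 := mul_le_mul_of_nonneg_left (mul_le_mul_of_nonneg_left h8
      (exp_pos (8 * lam1 + 1)).le) (by linarith : 0 ≤ 2 + t)
    have h10 : c * t ≤ 4 * (1 + L) / γ * (2 + t) := by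
      refine mul_le_mul (hc4.trans (div_le_div_of_nonneg_right (by linarith) hγ0.le))
        (by linarith) ht (by positivity)
    have h11 : U t - k * V t = D t + c * t := by simp only [hD]; ring
    rw [h11]
    refine (abs_add_le _ _).trans ?_
    rw [abs_of_nonneg (mul_nonneg hc0 ht)]
    have h12 : compConst lam1 κ * (1 + L) / γ * (2 + t) = (2 + t) * (exp (8 * lam1 + 1) *
      ((16 * lam1 + 17 * κ + 2) * (1 + L) / γ)) + 4 * (1 + L) / γ * (2 + t) := by
      rw [compConst]; ring
    linarith
  · have h1 : |p T| ≤ |D T| + (1 + T) * |q T| := by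
      refine (abs_sub _ _).trans ?_
      rw [abs_mul, abs_of_nonneg (by linarith : 0 ≤ 1 + T)]
    rw [hqT, hDT] at h1
    have := mul_le_mul_of_nonneg_left hkx (by linarith : 0 ≤ 1 + T)
    linarith
  · rw [hqT]
    have := mul_nonneg hT hsmall0
    linarith
  · intro s N hs hsT h1 h2
    have hN0 : 0 ≤ N := (abs_nonneg _).trans h1
    have hDs : |D s| ≤ (2 + s) * N := by
      rw [hDpq s]
      refine (abs_add_le _ _).trans ?_
      rw [abs_mul, abs_of_nonneg (by linarith : 0 ≤ 1 + s)]
      have := mul_le_mul_of_nonneg_left h2 (by linarith : 0 ≤ 1 + s)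
      linarith
    have hU0 := h.Unonneg hs.le
    have hUd : U s * dens β U s ≤ 15 / γ ^ 9 := by
      refine (mul_le_mul (h.U_le hl hβ hs.le) (hdens s hs.le hsT) (dens_nonneg hβ U s)
        hγ0.le).trans_eq ?_
      field_simp
    have hUd0 := mul_nonneg hU0 (dens_nonneg hβ U s)
    have hq's : q' s = -(lam1 * exp (-2 * s) * D s) - exp (-2 * s) * (lam1 * (c * s)) +
        exp (-2 * s) * (κ / γ * U s) - U s * dens β U s := by
      simp only [hq', hD]
      rw [← hε]
      ring
    have hq's_le : |q' s| ≤ lam1 * exp (-2 * s) * ((2 + s) * N) +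
        exp (-2 * s) * (lam1 * (4 / γ * s)) + exp (-2 * s) * (κ / γ * (L + 4 / γ * s)) +
        15 / γ ^ 9 := by
      have b1 : |lam1 * exp (-2 * s) * D s| ≤ lam1 * exp (-2 * s) * ((2 + s) * N) := by
        rw [abs_mul, abs_of_nonneg (by positivity : 0 ≤ lam1 * exp (-2 * s))]
        exact mul_le_mul_of_nonneg_left hDs (by positivity)
      have b2 : exp (-2 * s) * (lam1 * (c * s)) ≤ exp (-2 * s) * (lam1 * (4 / γ * s)) := by
        gcongr
      have b3 : exp (-2 * s) * (κ / γ * U s) ≤ exp (-2 * s) * (κ / γ * (L + 4 / γ * s)) := by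
        gcongr
        exact hUle s hs.le hsT
      have b4 : 0 ≤ exp (-2 * s) * (lam1 * (c * s)) := by positivity
      have b5 : 0 ≤ exp (-2 * s) * (κ / γ * U s) := by positivity
      rw [hq's, abs_le]
      rw [abs_le] at b1
      constructor <;> linarith [b1.1, b1.2]
    have hfin := one_add_mul_le hγ hl1 hκ hL0 hN0 hs.le (by nlinarith only [hγ, hsT, hTle]) hq's_le
    refine ⟨?_, ?_⟩
    · rw [abs_neg, abs_mul, abs_of_nonneg (by linarith : 0 ≤ 1 + s)]
      exact hfin
    · refine le_trans ?_ hfin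
      exact le_mul_of_one_le_left (abs_nonneg _) (by linarith)

/-- Pointwise comparison on the whole half-line, with the weight natural in `L²`. -/
theorem exp_neg_mul_sub_sq_le (h : Profile lam β γ U y) (hV : Profile lam1 0 v10 V x)
    (hl : 0 ≤ lam) (hκ : 0 ≤ κ) (hε : lam1 - lam = κ / γ) (hβ : 0 ≤ β) (hγ : 200 ≤ γ)
    (hexp : (lam1 + 1) * exp (-(γ ^ 2 / 200)) ≤ 1 / γ ^ 20) {T : ℝ} (hN : Neck β γ U y T)
    (hL : 71 * (log γ / γ) ≤ U T - y T * T) {t : ℝ} (ht : 0 ≤ t) :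
    exp (-t) * (U t - (U T - y T * T) / v10 * V t) ^ 2 ≤
      (2 * compConst lam1 κ * (1 + (U T - y T * T)) / γ) ^ 2 := by
  have hγ0 : 0 < γ := by linarith
  have hll : lam ≤ lam1 := by
    have : 0 ≤ κ / γ := by positivity
    linarith
  have hl1 := hl.trans hll
  have hT : 0 ≤ T := le_trans (by positivity) hN.T_ge
  have hv := hV.gamma_pos hl1 le_rfl
  have hL0 := h.intercept_nonneg hl hβ hT
  have hes : exp (-t) * exp t = 1 := by rw [← exp_add]; simp
  rcases le_total t T with htT | htT
  · have h1 := h.abs_sub_le hV hl hκ hε hβ hγ hexp hN hL ht htT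
    have h2 := pow_le_pow_left₀ (abs_nonneg _) h1 2
    rw [sq_abs] at h2
    have h3 := mul_le_mul_of_nonneg_left h2 (exp_pos (-t)).le
    refine h3.trans ?_
    have h4 : (2 + t) ^ 2 ≤ 4 * exp t := by
      have h5 : 2 + t ≤ 2 * exp (t / 2) := by linarith [add_one_le_exp (t / 2)]
      have h6 : exp t = exp (t / 2) ^ 2 := by rw [← exp_nat_mul]; push_cast; ring_nf
      rw [h6]
      nlinarith [exp_pos (t / 2)]
    have h5 := mul_le_mul_of_nonneg_left h4
      (show 0 ≤ exp (-t) * (compConst lam1 κ * (1 + (U T - y T * T)) / γ) ^ 2 by positivity)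
    have h6 : exp (-t) * (compConst lam1 κ * (1 + (U T - y T * T)) / γ) ^ 2 * (4 * exp t) =
      (2 * compConst lam1 κ * (1 + (U T - y T * T)) / γ) ^ 2 * (exp (-t) * exp t) := by ring
    rw [h6, hes, mul_one] at h5
    refine le_trans (le_of_eq ?_) h5
    ring
  · obtain ⟨e0, -, -⟩ := exp_neck_le hl1 hexp hN.T_ge
    have h0 : exp (-t) ≤ 1 / γ ^ 20 := (exp_le_exp.2 (by linarith)).trans e0
    set L := U T - y T * T with hLdef
    have h1 := h.Unonneg ht
    have h2 := h.U_le hl hβ ht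
    have h3 : 0 ≤ L / v10 * V t := mul_nonneg (div_nonneg hL0 hv.le) (hV.Unonneg ht)
    have h4 : L / v10 * V t ≤ L := by
      have := mul_le_mul_of_nonneg_left (hV.U_le hl1 le_rfl ht) (div_nonneg hL0 hv.le)
      rwa [div_mul_cancel₀ _ hv.ne'] at this
    have h5 : (U t - L / v10 * V t) ^ 2 ≤ (γ * (1 + L)) ^ 2 := by
      refine sq_le_sq' ?_ ?_ <;> nlinarith
    have h6 : exp (-t) * (U t - L / v10 * V t) ^ 2 ≤ 1 / γ ^ 20 * (γ * (1 + L)) ^ 2 :=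
      mul_le_mul h0 h5 (sq_nonneg _) (by positivity)
    refine h6.trans ?_
    have h7 : 1 / γ ^ 20 * (γ * (1 + L)) ^ 2 = ((1 + L) / γ) ^ 2 * (1 / γ ^ 16) := by field_simp
    have h8 : 1 / γ ^ 16 ≤ 1 := by
      rw [div_le_one (by positivity)]
      exact one_le_pow₀ (by linarith)
    have h9 : ((1 + L) / γ) ^ 2 ≤ (2 * compConst lam1 κ * (1 + L) / γ) ^ 2 := by
      refine pow_le_pow_left₀ (by positivity) ?_ 2
      refine div_le_div_of_nonneg_right ?_ hγ0.le
      have hC : 4 ≤ compConst lam1 κ := by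
        have : 0 ≤ exp (8 * lam1 + 1) * (16 * lam1 + 17 * κ + 2) := by positivity
        rw [compConst]
        linarith
      nlinarith
    have h10 := mul_le_mul_of_nonneg_left h8 (sq_nonneg ((1 + L) / γ))
    linarith

end Profile

/-! ### From radial solutions to profiles -/

theorem exp_neg_mem_Icc {t : ℝ} (ht : t ∈ Ici (0 : ℝ)) : exp (-t) ∈ Icc (0 : ℝ) 1 :=
  ⟨(exp_pos _).le, exp_le_one_iff.2 (neg_nonpos.2 ht)⟩

theorem exp_neg_mem_Ioo {t : ℝ} (ht : 0 < t) : exp (-t) ∈ Ioo (0 : ℝ) 1 :=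
  ⟨exp_pos _, exp_lt_one_iff.2 (neg_lt_zero.2 ht)⟩

theorem hasDerivAt_exp_neg (t : ℝ) : HasDerivAt (fun t : ℝ => exp (-t)) (-exp (-t)) t := by
  simpa using (hasDerivAt_id t).neg.exp

theorem tendsto_exp_neg_nhdsWithin :
    Tendsto (fun t : ℝ => exp (-t)) atTop (𝓝[Icc 0 1] 0) :=
  tendsto_nhdsWithin_iff.2 ⟨tendsto_exp_neg_atTop_nhds_zero,
    (eventually_ge_atTop 0).mono fun _ ht => exp_neg_mem_Icc ht⟩

theorem hasDerivAt_derivWithin {u : ℝ → ℝ} (hu : ContDiffOn ℝ (⊤ : ℕ∞) u (Icc 0 1)) {r : ℝ}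
    (hr : r ∈ Ioo (0 : ℝ) 1) : HasDerivAt u (derivWithin u (Icc 0 1) r) r := by
  have hn : Icc (0 : ℝ) 1 ∈ 𝓝 r := Icc_mem_nhds hr.1 hr.2
  exact ((hu.differentiableOn (by simp) r (Ioo_subset_Icc_self hr)).hasDerivWithinAt).hasDerivAt hn

namespace IsRadSol

variable {lam β γ : ℝ} {u : ℝ → ℝ}

theorem profile (h : IsRadSol lam β γ u) :
    Profile lam β γ (fun t => u (exp (-t)))
      (fun t => -(exp (-t) * derivWithin u (Icc 0 1) (exp (-t)))) := by
  obtain ⟨hs, heq, hpos, h1, h0⟩ := h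
  have hs' : ContDiffOn ℝ (⊤ : ℕ∞) (derivWithin u (Icc 0 1)) (Icc 0 1) :=
    hs.derivWithin (uniqueDiffOn_Icc one_pos) (by simp)
  have hce : ContinuousOn (fun t : ℝ => exp (-t)) (Ici 0) := by fun_prop
  have hm : MapsTo (fun t : ℝ => exp (-t)) (Ici 0) (Icc 0 1) := fun t ht => exp_neg_mem_Icc ht
  have z : (0 : ℝ) ∈ Icc (0 : ℝ) 1 := ⟨le_rfl, zero_le_one⟩
  refine ⟨hs.continuousOn.comp hce hm, (hce.mul (hs'.continuousOn.comp hce hm)).neg, ?_, ?_, ?_,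
    ?_, by simp [h1], fun t ht => hpos _ ⟨(exp_pos _).le, (exp_neg_mem_Ioo ht).2⟩⟩
  · intro t ht
    have := (hasDerivAt_derivWithin hs (exp_neg_mem_Ioo ht)).comp t (hasDerivAt_exp_neg t)
    refine this.congr_deriv ?_
    ring
  · intro t ht
    have hr := exp_neg_mem_Ioo ht
    have e1 : deriv u (exp (-t)) = derivWithin u (Icc 0 1) (exp (-t)) :=
      (hasDerivAt_derivWithin hs hr).deriv
    have e2 : deriv (deriv u) (exp (-t)) =
        derivWithin (derivWithin u (Icc 0 1)) (Icc 0 1) (exp (-t)) := by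
      have : deriv u =ᶠ[𝓝 (exp (-t))] derivWithin u (Icc 0 1) :=
        by
        filter_upwards [isOpen_Ioo.mem_nhds hr] with s hs1
        exact (hasDerivAt_derivWithin hs hs1).deriv
      rw [this.deriv_eq]
      exact (hasDerivAt_derivWithin hs' hr).deriv
    have e3 := heq _ hr
    rw [radLap, e1, e2] at e3
    have := ((hasDerivAt_exp_neg t).mul
      ((hasDerivAt_derivWithin hs' hr).comp t (hasDerivAt_exp_neg t))).neg
    refine this.congr_deriv ?_
    have e4 : derivWithin (derivWithin u (Icc 0 1)) (Icc 0 1) (exp (-t)) =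
        -(lam * u (exp (-t)) + β * u (exp (-t)) * exp (u (exp (-t)) ^ 2)) -
          derivWithin u (Icc 0 1) (exp (-t)) / exp (-t) := by linarith
    have e5 : exp (u (exp (-t)) ^ 2 - 2 * t) = exp (u (exp (-t)) ^ 2) * (exp (-t) * exp (-t)) := by
      rw [← exp_add, ← exp_add]; ring_nf
    have e6 : exp (-2 * t) = exp (-t) * exp (-t) := by rw [← exp_add]; ring_nf
    simp only [dens, Function.comp]
    rw [e4, e5, e6]
    have := (exp_pos (-t)).ne'
    field_simp
    ring
  · have := (hs.continuousOn 0 z).tendsto.comp tendsto_exp_neg_nhdsWithin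
    rw [h0] at this
    exact this
  · have := ((tendsto_exp_neg_atTop_nhds_zero).mul
      ((hs'.continuousOn 0 z).tendsto.comp tendsto_exp_neg_nhdsWithin)).neg
    simp only [zero_mul, neg_zero] at this
    exact this

theorem exists_pairing (h : IsRadSol lam β γ u) {lam' β' γ' : ℝ} {v : ℝ → ℝ}
    (h' : IsRadSol lam' β' γ' v) :
    ∃ a, Pairing (fun t => u (exp (-t))) (fun t => v (exp (-t))) a ∧
      a 0 = ∫ r in Ioo (0 : ℝ) 1, r * (u r * v r) := by
  have hcont : ContinuousOn (fun r : ℝ => r * (u r * v r)) (Icc 0 1) :=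
    continuousOn_id.mul (h.1.continuousOn.mul h'.1.continuousOn)
  set g : ℝ → ℝ := IccExtend zero_le_one ((Icc (0:ℝ) 1).domRestrict fun r => r * (u r * v r)) with hg
  have hgc : Continuous g := hcont.domRestrict.Icc_extend'
  have hgeq : ∀ r ∈ Icc (0 : ℝ) 1, g r = r * (u r * v r) := fun r hr => by
    rw [hg, IccExtend_of_mem _ _ hr]; rfl
  set F : ℝ → ℝ := fun r => ∫ s in (0:ℝ)..r, g s with hF
  have hFd : ∀ r, HasDerivAt F (g r) r := fun r =>
    (hgc.integral_hasStrictDerivAt 0 r).hasDerivAt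
  have hFc : Continuous F := continuous_iff_continuousAt.2 fun r => (hFd r).continuousAt
  refine ⟨fun t => F (exp (-t)), ⟨?_, ?_, ?_⟩, ?_⟩
  · exact (hFc.comp (continuous_exp.comp continuous_neg)).continuousOn
  · intro t ht
    refine ((hFd _).comp t (hasDerivAt_exp_neg t)).congr_deriv ?_
    rw [hgeq _ (exp_neg_mem_Icc ht.le)]
    have e6 : exp (-2 * t) = exp (-t) * exp (-t) := by rw [← exp_add]; ring_nf
    rw [e6]
    ring
  · have := (hFc.tendsto 0).comp tendsto_exp_neg_atTop_nhds_zero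
    simp only [hF, intervalIntegral.integral_same] at this
    exact this
  · simp only [hF, neg_zero, exp_zero]
    rw [intervalIntegral.integral_of_le zero_le_one, ← integral_Ioc_eq_integral_Ioo]
    exact setIntegral_congr_fun measurableSet_Ioc fun r hr => hgeq r (Ioc_subset_Icc_self hr)

end IsRadSol

theorem EigenCtx.isRadSol {lam1 : ℝ} {v1 : ℝ → ℝ} (h : EigenCtx lam1 v1) :
    IsRadSol lam1 0 (v1 0) v1 := by
  obtain ⟨-, hs, heq, hpos, h1, -⟩ := h
  exact ⟨hs, fun r hr => by rw [heq r hr]; ring, hpos, h1, rfl⟩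

/-! ### Consequences of the pointwise comparison -/

section Integral

variable {f g : ℝ → ℝ} {k δ M : ℝ}

theorem mul_abs_le_of_mul_sq_le {r d δ : ℝ} (hr : r ∈ Ioo (0 : ℝ) 1) (hδ : 0 ≤ δ)
    (h : r * d ^ 2 ≤ δ ^ 2) : r * |d| ≤ δ := by
  have h0 := hr.1
  refine abs_le_of_sq_le_sq (?_ : (r * |d|) ^ 2 ≤ δ ^ 2) hδ |> (le_abs_self _).trans
  have h1 : (r * |d|) ^ 2 = r * (r * d ^ 2) := by rw [mul_pow, sq_abs]; ring
  have h2 : r * (r * d ^ 2) ≤ 1 * (r * d ^ 2) :=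
    mul_le_mul_of_nonneg_right hr.2.le (mul_nonneg h0.le (sq_nonneg d))
  linarith

theorem integrableOn_Ioo_of_continuousOn_Icc {F : ℝ → ℝ} (hF : ContinuousOn F (Icc 0 1)) :
    IntegrableOn F (Ioo 0 1) :=
  (hF.integrableOn_compact isCompact_Icc).mono_set Ioo_subset_Icc_self

theorem abs_setIntegral_Ioo_le {F : ℝ → ℝ} {C : ℝ} (hF : ∀ r ∈ Ioo (0 : ℝ) 1, |F r| ≤ C) :
    |∫ r in Ioo (0 : ℝ) 1, F r| ≤ C := by
  have := norm_setIntegral_le_of_norm_le_const (μ := volume) (s := Ioo (0 : ℝ) 1) (f := F) (C := C)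
    (by simp) hF
  simpa using this

theorem abs_integral_mul_sub_le (hf : ContinuousOn f (Icc 0 1)) (hg : ContinuousOn g (Icc 0 1))
    (hδ : 0 ≤ δ) (hM : ∀ r ∈ Ioo (0 : ℝ) 1, |g r| ≤ M)
    (hone : ∫ r in Ioo (0 : ℝ) 1, (g r) ^ 2 * (2 * π * r) = 1)
    (h : ∀ r ∈ Ioo (0 : ℝ) 1, r * (f r - k * g r) ^ 2 ≤ δ ^ 2) :
    |2 * π * (∫ r in Ioo (0 : ℝ) 1, r * (f r * g r)) - k| ≤ 2 * π * (M * δ) := by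
  have h1 : 2 * π * (∫ r in Ioo (0 : ℝ) 1, r * (f r * g r)) - k =
      ∫ r in Ioo (0 : ℝ) 1, (2 * π * (r * (f r * g r)) - k * ((g r) ^ 2 * (2 * π * r))) := by
    rw [integral_sub, integral_const_mul, integral_const_mul, hone, mul_one]
    · exact integrableOn_Ioo_of_continuousOn_Icc (by fun_prop)
    · exact integrableOn_Ioo_of_continuousOn_Icc (by fun_prop)
  rw [h1]
  refine abs_setIntegral_Ioo_le fun r hr => ?_
  have h2 : 2 * π * (r * (f r * g r)) - k * ((g r) ^ 2 * (2 * π * r)) =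
      2 * π * (g r * (r * (f r - k * g r))) := by ring
  have h3 := mul_abs_le_of_mul_sq_le hr hδ (h r hr)
  rw [h2, abs_mul, abs_of_pos (by positivity : 0 < 2 * π), abs_mul, abs_mul, abs_of_pos hr.1]
  refine mul_le_mul_of_nonneg_left ?_ (by positivity)
  exact mul_le_mul (hM r hr) h3 (mul_nonneg hr.1.le (abs_nonneg _))
    ((abs_nonneg _).trans (hM r hr))

theorem abs_integral_sq_sub_le (hf : ContinuousOn f (Icc 0 1)) (hg : ContinuousOn g (Icc 0 1))
    (hδ : 0 ≤ δ) (hk : 0 ≤ k) (hM : ∀ r ∈ Ioo (0 : ℝ) 1, |g r| ≤ M)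
    (hone : ∫ r in Ioo (0 : ℝ) 1, (g r) ^ 2 * (2 * π * r) = 1)
    (h : ∀ r ∈ Ioo (0 : ℝ) 1, r * (f r - k * g r) ^ 2 ≤ δ ^ 2) :
    |(∫ r in Ioo (0 : ℝ) 1, (f r) ^ 2 * (2 * π * r)) - k ^ 2| ≤
      2 * π * (δ ^ 2 + 2 * k * (M * δ)) := by
  have h1 : (∫ r in Ioo (0 : ℝ) 1, (f r) ^ 2 * (2 * π * r)) - k ^ 2 =
      ∫ r in Ioo (0 : ℝ) 1, ((f r) ^ 2 * (2 * π * r) - k ^ 2 * ((g r) ^ 2 * (2 * π * r))) := by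
    rw [integral_sub, integral_const_mul, hone, mul_one]
    · exact integrableOn_Ioo_of_continuousOn_Icc (by fun_prop)
    · exact integrableOn_Ioo_of_continuousOn_Icc (by fun_prop)
  rw [h1]
  refine abs_setIntegral_Ioo_le fun r hr => ?_
  have h2 : (f r) ^ 2 * (2 * π * r) - k ^ 2 * ((g r) ^ 2 * (2 * π * r)) =
      2 * π * (r * (f r - k * g r) ^ 2 + 2 * k * (g r * (r * (f r - k * g r)))) := by ring
  have h3 := mul_abs_le_of_mul_sq_le hr hδ (h r hr)
  rw [h2, abs_mul, abs_of_pos (by positivity : 0 < 2 * π)]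
  refine mul_le_mul_of_nonneg_left ?_ (by positivity)
  refine (abs_add_le _ _).trans (add_le_add ?_ ?_)
  · rw [abs_of_nonneg (mul_nonneg hr.1.le (sq_nonneg _))]
    exact h r hr
  · rw [abs_mul, abs_of_nonneg (by positivity : 0 ≤ 2 * k), abs_mul, abs_mul, abs_of_pos hr.1]
    refine mul_le_mul_of_nonneg_left ?_ (by positivity)
    exact mul_le_mul (hM r hr) h3 (mul_nonneg hr.1.le (abs_nonneg _))
      ((abs_nonneg _).trans (hM r hr))

end Integral

/-! ### The approximation for large central value -/

theorem exists_exp_neg_two_le {lam1 : ℝ} (hl1 : 0 < lam1) :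
    ∃ t, 0 < t ∧ lam1 * exp (-2 * t) ≤ 1 / 12 := by
  refine ⟨6 * lam1, by positivity, ?_⟩
  have h1 : 12 * lam1 ≤ exp (12 * lam1) := by linarith [add_one_le_exp (12 * lam1)]
  have h2 : exp (-2 * (6 * lam1)) * exp (12 * lam1) = 1 := by
    rw [← exp_add, ← exp_zero]; ring_nf
  have h3 := mul_le_mul_of_nonneg_left h1 (exp_pos (-2 * (6 * lam1))).le
  linarith

theorem tendsto_log_div_atTop : Tendsto (fun γ : ℝ => log γ / γ) atTop (𝓝 0) :=
  isLittleO_log_id_atTop.tendsto_div_nhds_zero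

theorem eventually_exp_le (lam1 : ℝ) :
    ∀ᶠ γ : ℝ in atTop, (lam1 + 1) * exp (-(γ ^ 2 / 200)) ≤ 1 / γ ^ 20 := by
  have h1 := (tendsto_pow_mul_exp_neg_atTop_nhds_zero 10).const_mul ((lam1 + 1) * 200 ^ 10)
  have h2 : Tendsto (fun γ : ℝ => γ ^ 2 / 200) atTop atTop :=
    (tendsto_pow_atTop two_ne_zero).atTop_div_const (by norm_num)
  have h3 := h1.comp h2
  rw [mul_zero] at h3
  filter_upwards [h3.eventually (gt_mem_nhds one_pos), eventually_gt_atTop 0] with γ h4 h5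
  rw [le_div_iff₀ (by positivity)]
  refine le_trans (le_of_eq ?_) h4.le
  simp only [Function.comp]
  ring

/-- For large central value `γ`, a solution is close to a multiple of the first eigenfunction,
and the multiple is determined by `β`. -/
theorem eventually_approx {lam1 : ℝ} {v1 : ℝ → ℝ} (hE : EigenCtx lam1 v1) {κ : ℝ} (hκ : 0 < κ) :
    ∀ᶠ γ : ℝ in atTop, ∀ (β : ℝ) (u : ℝ → ℝ), 0 < β → IsRadSol (lam1 - κ / γ) β γ u →
      ∃ L, 0 ≤ L ∧ |L - log (1 / β) / γ| ≤ 400 * (log γ / γ) ∧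
        |κ * (∫ r in Ioo (0 : ℝ) 1, r * (u r * v1 r)) - 2 * v1 0| ≤ v1 0 * (4 / γ) ∧
        ∀ r ∈ Ioo (0 : ℝ) 1, r * (u r - L / v1 0 * v1 r) ^ 2 ≤
          (2 * compConst lam1 κ * (1 + L) / γ) ^ 2 := by
  have hl1 := hE.1
  have hV := hE.isRadSol.profile
  have hv := hV.gamma_pos hl1.le le_rfl
  obtain ⟨t₁, ht₁, hlt₁⟩ := exists_exp_neg_two_le hl1
  have hVt := hV.Upos t₁ ht₁
  have z : Tendsto (fun γ : ℝ => 1 / γ) atTop (𝓝 0) := by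
    simpa using tendsto_inv_atTop_zero (𝕜 := ℝ)
  have E1 : ∀ᶠ γ : ℝ in atTop, κ * (1 / γ) < lam1 :=
    (z.const_mul κ).eventually (gt_mem_nhds (by simpa using hl1))
  have E2 : ∀ᶠ γ : ℝ in atTop, v1 0 * (32 + 15 * exp (2 * t₁) * t₁) * (1 / γ) <
      κ * (5 / 6 * v1 (exp (-t₁)) * exp (-2 * t₁) / 2) :=
    (z.const_mul _).eventually (gt_mem_nhds (by rw [mul_zero]; positivity))
  have E3 : ∀ᶠ γ : ℝ in atTop, 71 * (log γ / γ) + (6 / κ + 3) * (1 / γ) < 4 / κ :=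
    ((tendsto_log_div_atTop.const_mul 71).add (z.const_mul (6 / κ + 3))).eventually
      (gt_mem_nhds (by rw [mul_zero, mul_zero, add_zero]; positivity))
  have E4 : ∀ᶠ γ : ℝ in atTop, 70 * (log γ / γ) < 1 :=
    (tendsto_log_div_atTop.const_mul 70).eventually (gt_mem_nhds (by norm_num))
  filter_upwards [E1, E2, E3, E4, eventually_exp_le lam1, eventually_ge_atTop 200] with
    γ e1 e2 e3 e4 hexp hγ β u hβ hu
  have hγ0 : 0 < γ := by linarith
  have hlog : 70 * log γ ≤ γ := by
    have : 70 * log γ = 70 * (log γ / γ) * γ := by field_simp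
    rw [this]
    nlinarith
  have hκγ : 0 < κ / γ := by positivity
  have hl : 0 ≤ lam1 - κ / γ := by
    have : κ / γ = κ * (1 / γ) := by ring
    linarith
  have hll : lam1 - κ / γ ≤ lam1 := by linarith
  have hε : lam1 - (lam1 - κ / γ) = κ / γ := by ring
  have h := hu.profile
  obtain ⟨a, ha, ha0⟩ := hu.exists_pairing hE.isRadSol
  obtain ⟨T₀, hT₀, hy⟩ := h.exists_slope hl hβ.le (by linarith)
  have hUT := h.le_U_of_slope hl hβ.le (by linarith) hT₀.le hy
  obtain ⟨T₁, hT₁, hTT, hU⟩ := h.exists_level (by linarith) hT₀.le hUT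
  have ht : t₁ < T₁ := by
    by_contra! hc
    have h1 := Pairing.level_bound h hV ha hl hll hβ.le (by linarith) hT₁ hTT hT₀ hU hy hc
    rw [hε] at h1
    have h2 : κ / γ * (5 / 6 * γ * v1 (exp (-t₁)) * exp (-2 * t₁) / 2) =
        κ * (5 / 6 * v1 (exp (-t₁)) * exp (-2 * t₁) / 2) := by field_simp
    have h3 : v1 0 * (32 / γ + 15 / γ * exp (2 * t₁) * t₁) =
      v1 0 * (32 + 15 * exp (2 * t₁) * t₁) * (1 / γ) := by ring
    linarith
  have hs : (lam1 - κ / γ) * exp (-2 * T₁) ≤ 1 / 12 :=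
    (mul_le_mul hll (exp_le_exp.2 (by linarith)) (exp_pos _).le hl1.le).trans hlt₁
  have hgap := h.slope_sub_level hl hβ.le (by linarith) hT₁ hTT hU hUT hs
  have hN := h.neck_of_level hl hll hβ.le hγ hlog hexp hT₁ hU hy hgap
  set T := T₀ - 16 * log γ
  have hT : 0 ≤ T := le_trans (by positivity) hN.T_ge
  have hlow := Pairing.neck_lower h hV ha hl hll hβ.le hγ hexp hN
  have hint := Pairing.intercept_lower h hV ha hl hll hβ.le hγ hexp hN
  have hL0 := h.intercept_nonneg hl hβ.le hT
  have hlogL := h.intercept_log hl hβ hγ hN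
  have hlow' : v1 0 * (2 - 3 / γ) ≤ κ * a 0 := by
    rw [hε] at hlow
    have h1 := mul_le_mul_of_nonneg_right hlow hγ0.le
    have h2 : v1 0 * (2 / γ - 3 / γ ^ 2) * γ = v1 0 * (2 - 3 / γ) := by field_simp
    have h3 : κ / γ * a 0 * γ = κ * a 0 := by field_simp
    rwa [h2, h3] at h1
  have hL : 71 * (log γ / γ) ≤ (fun t => u (exp (-t))) T -
      (fun t => -(exp (-t) * derivWithin u (Icc 0 1) (exp (-t)))) T * T := by
    refine le_of_mul_le_mul_left ?_ hv
    have h1 : v1 0 * (4 / κ - 6 / κ * (1 / γ)) ≤ 2 * a 0 := by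
      have h2 := mul_le_mul_of_nonneg_left hlow' (show 0 ≤ 2 / κ by positivity)
      have h3 : 2 / κ * (κ * a 0) = 2 * a 0 := by field_simp
      rw [h3] at h2
      refine le_trans (le_of_eq ?_) h2
      ring
    have h4 := mul_le_mul_of_nonneg_left e3.le hv.le
    have h5 : v1 0 * (3 / γ) = v1 0 * (3 * (1 / γ)) := by ring
    linarith
  have hup := Pairing.neck_upper h hV ha hl hll hβ.le hγ hlog hN hL
  have hup' : κ * a 0 ≤ v1 0 * (2 + 4 / γ) := by
    rw [hε] at hup
    have h1 := mul_le_mul_of_nonneg_right hup hγ0.le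
    have h2 : v1 0 * (2 / γ + 4 / γ ^ 2) * γ = v1 0 * (2 + 4 / γ) := by field_simp
    have h3 : κ / γ * a 0 * γ = κ * a 0 := by field_simp
    rwa [h2, h3] at h1
  refine ⟨_, hL0, hlogL, ?_, fun r hr => ?_⟩
  · rw [← ha0, abs_le]
    have h1 : v1 0 * (4 / γ) = 4 * (v1 0 * (1 / γ)) := by ring
    have h2 : v1 0 * (3 / γ) = 3 * (v1 0 * (1 / γ)) := by ring
    have h3 : 0 ≤ v1 0 * (1 / γ) := by positivity
    constructor <;> linarith
  · have h1 := h.exp_neg_mul_sub_sq_le hV hl hκ.le hε hβ.le hγ hexp hN hL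
      (t := -log r) (neg_nonneg.2 (log_nonpos hr.1.le hr.2.le))
    simp only [neg_neg, exp_log hr.1] at h1
    exact h1

/-- As γ → +∞, ‖u_γ‖_{L²(Ω)} → √(l/λ₁) and
γ⁻¹ log(1/β_γ) = v₁(0)‖u_γ‖₂ + o(‖u_γ‖₂); in particular β_γ = o(1/γ). -/
theorem statement11 (lam1 : ℝ) (v1 : ℝ → ℝ) (hE : EigenCtx lam1 v1) (l : ℝ) (hl : 0 < l)
    (β : ℝ → ℝ) (u : ℝ → ℝ → ℝ) (hF : GoodFamily lam1 v1 l β u) :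
    Tendsto (fun γ : ℝ => l2norm (u γ)) atTop (𝓝 (Real.sqrt (l / lam1))) ∧
    (∀ ε : ℝ, 0 < ε → ∀ᶠ γ in atTop,
      |Real.log (1 / β γ) / γ - v1 0 * l2norm (u γ)| ≤ ε * l2norm (u γ)) ∧
    Tendsto (fun γ : ℝ => γ * β γ) atTop (𝓝 0) := by
  have hv : 0 < v1 0 := hE.isRadSol.profile.gamma_pos hE.1.le le_rfl
  have hs : 0 < sqrt (l / lam1) := sqrt_pos.2 (div_pos hl hE.1)
  set s := sqrt (l / lam1) with hsdef
  have hs' : sqrt (lam1 / l) = 1 / s := by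
    rw [hsdef, ← inv_div, sqrt_inv, one_div]
  set κ := 4 * π * v1 0 / s with hκdef
  have hκ : 0 < κ := by positivity
  have hbar : ∀ γ, lamBar lam1 (v1 0) l γ = lam1 - κ / γ := by
    intro γ
    rw [lamBar, hs', hκdef]
    ring
  have z : Tendsto (fun γ : ℝ => 1 / γ) atTop (𝓝 0) := by
    simpa using tendsto_inv_atTop_zero (𝕜 := ℝ)
  have hgood : ∀ᶠ γ : ℝ in atTop, 0 < β γ ∧ IsRadSol (lam1 - κ / γ) (β γ) γ (u γ) := by
    have E1 : ∀ᶠ γ : ℝ in atTop, κ * (1 / γ) < lam1 :=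
      (z.const_mul κ).eventually (gt_mem_nhds (by simpa using hE.1))
    filter_upwards [E1, eventually_gt_atTop 0] with γ e1 e2
    rw [← hbar]
    refine hF γ e2 ?_
    rw [hbar]
    have : κ / γ = κ * (1 / γ) := by ring
    linarith
  have hMv : ∀ r ∈ Ioo (0 : ℝ) 1, |v1 r| ≤ v1 0 := by
    intro r hr
    have h1 := hE.isRadSol.profile.U_le hE.1.le le_rfl (neg_nonneg.2 (log_nonpos hr.1.le hr.2.le))
    simp only [neg_neg, exp_log hr.1] at h1
    rwa [abs_of_pos (hE.2.2.2.1 r ⟨hr.1.le, hr.2⟩)]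
  set D := 2 * compConst lam1 κ with hD
  have hD0 : 0 ≤ D := by
    have := hE.1
    rw [hD, compConst]
    positivity
  set I : ℝ → ℝ := fun γ => ∫ r in Ioo (0 : ℝ) 1, r * (u γ r * v1 r) with hI
  set S : ℝ → ℝ := fun γ => ∫ r in Ioo (0 : ℝ) 1, (u γ r) ^ 2 * (2 * π * r) with hS
  set b : ℝ → ℝ := fun γ => log (1 / β γ) / γ with hb
  have hev : ∀ᶠ γ : ℝ in atTop, ∃ L, 0 ≤ L ∧ |L - b γ| ≤ 400 * (log γ / γ) ∧
      |κ * I γ - 2 * v1 0| ≤ v1 0 * (4 / γ) ∧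
      |2 * π * I γ - L / v1 0| ≤ 2 * π * (v1 0 * (D * (1 + L) / γ)) ∧
      |S γ - (L / v1 0) ^ 2| ≤ 2 * π * ((D * (1 + L) / γ) ^ 2 +
        2 * (L / v1 0) * (v1 0 * (D * (1 + L) / γ))) := by
    filter_upwards [eventually_approx hE hκ, hgood, eventually_gt_atTop 0] with γ h1 h2 h3
    obtain ⟨L, hL, hLb, hLI, hLr⟩ := h1 (β γ) (u γ) h2.1 h2.2
    have hδ : 0 ≤ D * (1 + L) / γ := by positivity
    exact ⟨L, hL, hLb, hLI,
      abs_integral_mul_sub_le h2.2.1.continuousOn hE.2.1.continuousOn hδ hMv hE.2.2.2.2.2 hLr,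
      abs_integral_sq_sub_le h2.2.1.continuousOn hE.2.1.continuousOn hδ (div_nonneg hL hv.le)
        hMv hE.2.2.2.2.2 hLr⟩
  obtain ⟨L, hL⟩ := hev.choice
  have limI : Tendsto (fun γ => 2 * π * I γ) atTop (𝓝 s) := by
    have h1 : Tendsto (fun γ => κ * I γ - 2 * v1 0) atTop (𝓝 0) := by
      refine squeeze_zero_norm' (hL.mono fun γ h => h.2.2.1) ?_
      have := z.const_mul (v1 0 * 4)
      rw [mul_zero] at this
      exact this.congr fun γ => by ring
    have h2 := (h1.add_const (2 * v1 0)).const_mul (2 * π / κ)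
    rw [zero_add] at h2
    have e : 2 * π / κ * (2 * v1 0) = s := by rw [hκdef]; field_simp; norm_num
    rw [e] at h2
    refine h2.congr fun γ => ?_
    field_simp
    ring
  have hLb : ∀ᶠ γ in atTop, L γ ≤ 2 * v1 0 * (s + 1) + 1 := by
    have E1 : ∀ᶠ γ : ℝ in atTop, 2 * π * v1 0 ^ 2 * D * (1 / γ) < 1 / 2 :=
      (z.const_mul _).eventually (gt_mem_nhds (by norm_num))
    have E2 : ∀ᶠ γ : ℝ in atTop, 2 * π * I γ < s + 1 := limI.eventually (gt_mem_nhds (by linarith))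
    filter_upwards [hL, E1, E2] with γ h e1 e2
    have h1 := (abs_le.1 h.2.2.2.1).1
    have h2 := mul_le_mul_of_nonneg_left (show L γ / v1 0 ≤ 2 * π * I γ +
      2 * π * (v1 0 * (D * (1 + L γ) / γ)) by linarith) hv.le
    rw [mul_div_cancel₀ _ hv.ne'] at h2
    have h3 := mul_le_mul_of_nonneg_right e1.le (show 0 ≤ 1 + L γ by linarith [h.1])
    have h4 := mul_le_mul_of_nonneg_left e2.le hv.le
    have h5 : v1 0 * (2 * π * I γ + 2 * π * (v1 0 * (D * (1 + L γ) / γ))) =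
      v1 0 * (2 * π * I γ) + 2 * π * v1 0 ^ 2 * D * (1 / γ) * (1 + L γ) := by ring
    linarith
  have limδ : Tendsto (fun γ => D * (1 + L γ) / γ) atTop (𝓝 0) := by
    have h1 := z.const_mul (D * (2 * v1 0 * (s + 1) + 2))
    rw [mul_zero] at h1
    refine squeeze_zero' ?_ ?_ h1
    · filter_upwards [hL, eventually_gt_atTop 0] with γ h h0
      have := h.1
      positivity
    · filter_upwards [hL, hLb, eventually_gt_atTop 0] with γ h h1 h0
      rw [mul_one_div]
      exact div_le_div_of_nonneg_right (mul_le_mul_of_nonneg_left (by linarith) hD0) h0.le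
  have limk : Tendsto (fun γ => L γ / v1 0) atTop (𝓝 s) := by
    have h1 : Tendsto (fun γ => 2 * π * I γ - L γ / v1 0) atTop (𝓝 0) := by
      refine squeeze_zero_norm' (hL.mono fun γ h => h.2.2.2.1) ?_
      have := (limδ.const_mul (v1 0)).const_mul (2 * π)
      simp only [mul_zero] at this
      exact this
    have h2 := limI.sub h1
    rw [sub_zero] at h2
    exact h2.congr fun γ => by ring
  have limS : Tendsto S atTop (𝓝 (s ^ 2)) := by
    have h1 : Tendsto (fun γ => S γ - (L γ / v1 0) ^ 2) atTop (𝓝 0) := by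
      refine squeeze_zero_norm' (hL.mono fun γ h => h.2.2.2.2) ?_
      have := ((limδ.pow 2).add ((limk.const_mul 2).mul (limδ.const_mul (v1 0)))).const_mul (2 * π)
      simp only [mul_zero, ne_eq, OfNat.ofNat_ne_zero, not_false_eq_true, zero_pow,
        add_zero] at this
      exact this
    have h2 := h1.add (limk.pow 2)
    rw [zero_add] at h2
    exact h2.congr fun γ => by ring
  have limN : Tendsto (fun γ => l2norm (u γ)) atTop (𝓝 s) := by
    have := (continuous_sqrt.tendsto _).comp limS
    rw [sqrt_sq hs.le] at this
    exact this
  have limb : Tendsto b atTop (𝓝 (v1 0 * s)) := by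
    have h1 : Tendsto (fun γ => L γ - b γ) atTop (𝓝 0) := by
      refine squeeze_zero_norm' (hL.mono fun γ h => h.2.1) ?_
      have := tendsto_log_div_atTop.const_mul 400
      rwa [mul_zero] at this
    have h2 := (limk.const_mul (v1 0)).sub h1
    rw [sub_zero] at h2
    refine h2.congr fun γ => ?_
    rw [mul_div_cancel₀ _ hv.ne']
    ring
  refine ⟨limN, fun ε hε => ?_, ?_⟩
  · have h1 := (limb.sub (limN.const_mul (v1 0))).abs
    rw [sub_self, abs_zero] at h1
    filter_upwards [h1.eventually (gt_mem_nhds (show 0 < ε * (s / 2) by positivity)),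
      limN.eventually (lt_mem_nhds (half_lt_self hs))] with γ h2 h3
    exact h2.le.trans (mul_le_mul_of_nonneg_left h3.le hε.le)
  · have hm : 0 < v1 0 * s := mul_pos hv hs
    set m := v1 0 * s
    have h1 : Tendsto (fun γ : ℝ => γ * exp (-(m / 2 * γ))) atTop (𝓝 0) := by
      have h2 : Tendsto (fun γ : ℝ => m / 2 * γ) atTop atTop :=
        tendsto_id.const_mul_atTop (by positivity)
      have h3 := ((tendsto_pow_mul_exp_neg_atTop_nhds_zero 1).comp h2).const_mul (2 / m)
      rw [mul_zero] at h3
      refine h3.congr fun γ => ?_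
      simp only [Function.comp, pow_one]
      field_simp
    refine squeeze_zero' ?_ ?_ h1
    · filter_upwards [hgood, eventually_gt_atTop 0] with γ h2 h3
      exact mul_nonneg h3.le h2.1.le
    · filter_upwards [hgood, eventually_gt_atTop 0,
        limb.eventually (lt_mem_nhds (half_lt_self hm))] with γ h2 h3 h4
      refine mul_le_mul_of_nonneg_left ?_ h3.le
      have h5 : m / 2 * γ ≤ -log (β γ) := by
        simp only [hb, one_div, log_inv] at h4
        rw [lt_div_iff₀ h3] at h4
        exact h4.le
      rw [← exp_log h2.1]
      exact exp_le_exp.2 (by linarith)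

end
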